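/- Let p be a prime with p ≡ 1 (mod 3), let β ∈ F_p satisfy β² = −27, and let χ : F_p → ℂ be a multiplicative character of order 3 (extended by χ(0) = 0). Define the global character sum S = ∑_{z ∈ F_p, z ≠ 0} ∑_{(x,y) ∈ F_p × F_p with y² = x³ − 27z²} {x}·χ(y − βz). Then S = p·(h_p* − (p−1)/2); in particular S is a rational integer. -/

import Mathlib

open Finset Polynomial

theorem ZMod.sum_val (p : ℕ) [NeZero p] :
    ∑ x : ZMod p, (x.val : ℂ) = (p : ℂ) * ((p : ℂ) - 1) / 2 := by
  have h : ∑ x : ZMod p, (x.val : ℂ) = ∑ i ∈ range p, (i : ℂ) := by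
    obtain ⟨n, rfl⟩ := Nat.exists_eq_succ_of_ne_zero (NeZero.ne p)
    exact Fin.sum_univ_eq_sum_range (fun i => (i : ℂ)) (n + 1)
  rw [h]
  have := Finset.sum_range_id_mul_two p
  have h2 : ((∑ i ∈ range p, i : ℕ) : ℂ) * 2 = p * ((p - 1 : ℕ) : ℂ) := by exact_mod_cast this
  rw [Nat.cast_sub (Nat.one_le_iff_ne_zero.2 (NeZero.ne p))] at h2
  push_cast at h2
  linear_combination h2 / 2

/-- The substitution `u = y - βz`, `v = y + βz` turns the surface `y² = x³ + β²z²` into `uv = x³`. -/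
theorem sum_surface_eq_sum_pairs {F : Type*} [Field F] [Fintype F] [DecidableEq F]
    (β : F) (h2 : (2 : F) ≠ 0) (hβ0 : β ≠ 0) (hβ : β ^ 2 = -27) (f : F → F → ℂ) :
    (∑ z ∈ univ.filter (fun z : F => z ≠ 0),
        ∑ P ∈ univ.filter (fun P : F × F => P.2 ^ 2 = P.1 ^ 3 - 27 * z ^ 2),
          f P.1 (P.2 - β * z))
      = ∑ x : F, ∑ u : F, ∑ _v ∈ univ.filter (fun v : F => u * v = x ^ 3 ∧ u ≠ v), f x u := by
  rw [Finset.sum_sigma', Finset.sum_sigma', Finset.sum_sigma']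
  refine Finset.sum_bij' (fun a _ => ⟨⟨a.2.1, a.2.2 - β * a.1⟩, a.2.2 + β * a.1⟩)
    (fun b _ => ⟨(b.2 - b.1.2) / (2 * β), (b.1.1, (b.1.2 + b.2) / 2)⟩) ?_ ?_ ?_ ?_ ?_
  · rintro ⟨z, x, y⟩ h
    simp only [mem_sigma, mem_filter, mem_univ, true_and] at h ⊢
    refine ⟨by linear_combination h.2 - z ^ 2 * hβ, fun e => ?_⟩
    have : 2 * β * z = 0 := by linear_combination - e
    simp_all
  · rintro ⟨⟨x, u⟩, v⟩ h
    simp only [mem_sigma, mem_filter, mem_univ, true_and] at h ⊢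
    refine ⟨div_ne_zero (sub_ne_zero.2 (Ne.symm h.2)) (mul_ne_zero h2 hβ0), ?_⟩
    have h27 : (27 : F) = - β ^ 2 := by rw [hβ]; ring
    rw [h27]
    field_simp
    linear_combination 4 * h.1
  · rintro ⟨z, x, y⟩ h
    simp only [Sigma.mk.injEq, heq_eq_eq, Prod.mk.injEq, true_and]
    constructor <;> field_simp <;> ring
  · rintro ⟨⟨x, u⟩, v⟩ h
    simp only [Sigma.mk.injEq, heq_eq_eq, true_and]
    constructor <;> field_simp <;> ring
  · rintro ⟨z, x, y⟩ h
    rfl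

theorem sum_mulChar_of_mul_eq_cube {F : Type*} [Field F] [Fintype F] [DecidableEq F]
    (hF : ringChar F ≠ 2) (χ : MulChar F ℂ) (hχ1 : χ ≠ 1) (hχ3 : χ ^ 3 = 1) (x : F) :
    ∑ u : F, ∑ _v ∈ univ.filter (fun v : F => u * v = x ^ 3 ∧ u ≠ v), χ u
      = if x = 0 then 0 else -(1 + (quadraticChar F x : ℂ)) := by
  have key : ∀ u : F, ∑ _v ∈ univ.filter (fun v : F => u * v = x ^ 3 ∧ u ≠ v), χ u
      = χ u - if u ^ 2 = x ^ 3 then χ u else 0 := by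
    intro u
    by_cases hu : u = 0
    · subst hu; simp [MulChar.map_zero χ]
    · have : univ.filter (fun v : F => u * v = x ^ 3 ∧ u ≠ v)
          = if u ^ 2 = x ^ 3 then ∅ else {x ^ 3 / u} := by
        ext v
        have e : u * v = x ^ 3 ↔ v = x ^ 3 / u := by
          rw [eq_div_iff hu, mul_comm]
        split_ifs with h
        · simp only [mem_filter, mem_univ, true_and, notMem_empty, iff_false, not_and, not_not]
          intro h'
          rw [← h, pow_two] at h'
          exact (mul_left_cancel₀ hu h').symm
        · simp only [mem_filter, mem_univ, true_and, mem_singleton, e, and_iff_left_iff_imp]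
          rintro h' rfl
          exact h (by rw [pow_two, e, ← h'])
      rw [this]
      split_ifs <;> simp
  simp only [key, Finset.sum_sub_distrib, MulChar.sum_eq_zero_of_ne_one hχ1, zero_sub]
  split_ifs with hx
  · subst hx
    rw [neg_eq_zero]
    refine Finset.sum_eq_zero fun u _ => ?_
    split_ifs with h
    · have : u = 0 := by simpa using h
      rw [this, MulChar.map_zero χ]
    · rfl
  · congr 1
    have hc : ((univ.filter (fun t : F => t ^ 2 = x)).card : ℤ) = quadraticChar F x + 1 := by
      rw [← quadraticChar_card_sqrts hF x]
      congr 1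
      refine congrArg Finset.card ?_
      ext a; simp
    have hc' : (1 + (quadraticChar F x : ℂ)) = ∑ t ∈ univ.filter (fun t : F => t ^ 2 = x), 1 := by
      rw [Finset.sum_const, nsmul_eq_mul, mul_one, add_comm]
      exact_mod_cast hc.symm
    rw [hc', ← Finset.sum_filter]
    refine Finset.sum_bij' (fun u _ => u / x) (fun t _ => t ^ 3) ?_ ?_ ?_ ?_ ?_
    · intro u hu
      simp only [mem_filter, mem_univ, true_and] at hu ⊢
      rw [div_pow, hu]; field_simp
    · intro t ht
      simp only [mem_filter, mem_univ, true_and] at ht ⊢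
      rw [← ht]; ring
    · intro u hu
      simp only [mem_filter, mem_univ, true_and] at hu
      field_simp
      linear_combination u * hu
    · intro t ht
      simp only [mem_filter, mem_univ, true_and] at ht
      field_simp
      linear_combination t * ht
    · intro u hu
      simp only [mem_filter, mem_univ, true_and] at hu
      have hu' : u = (u / x) ^ 3 := by
        field_simp
        linear_combination - u * hu
      have h0 : u ≠ 0 := by
        rintro rfl
        exact hx (by simpa using hu.symm)
      rw [hu', map_pow, ← MulChar.pow_apply' χ (by norm_num), hχ3,
        MulChar.one_apply (IsUnit.mk0 _ (div_ne_zero h0 hx))]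

theorem global_sum_eq_quadraticChar_sum (p : ℕ) [Fact p.Prime] (hp3 : p % 3 = 1)
    (β : ZMod p) (hβ : β ^ 2 = -27) (χ : MulChar (ZMod p) ℂ) (hχ : orderOf χ = 3) :
    (∑ z ∈ univ.filter (fun z : ZMod p => z ≠ 0),
        ∑ P ∈ univ.filter
            (fun P : ZMod p × ZMod p => P.2 ^ 2 = P.1 ^ 3 - 27 * z ^ 2),
          (P.1.val : ℂ) * χ (P.2 - β * z))
      = - ((p : ℂ) * ((p : ℂ) - 1) / 2)
        - ∑ x : ZMod p, (x.val : ℂ) * (quadraticChar (ZMod p) x : ℂ) := by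
  have hp2 : p ≠ 2 := by rintro rfl; omega
  have hp3' : ¬ p ∣ 3 := fun h => by
    rw [Nat.prime_dvd_prime_iff_eq Fact.out Nat.prime_three] at h
    subst h; omega
  have h3 : (3 : ZMod p) ≠ 0 := by
    intro h
    exact hp3' ((ZMod.natCast_eq_zero_iff 3 p).1 (by exact_mod_cast h))
  have hr : ringChar (ZMod p) ≠ 2 := by rwa [ZMod.ringChar_zmod_n]
  have hβ0 : β ≠ 0 := by
    rintro rfl
    have : (3 : ZMod p) ^ 3 = 0 := by linear_combination hβ
    exact h3 (by simpa using this)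
  have hχ1 : χ ≠ 1 := by
    rintro rfl
    simp at hχ
  have hχ3 : χ ^ 3 = 1 := by rw [← hχ]; exact pow_orderOf_eq_one χ
  rw [sum_surface_eq_sum_pairs β (Ring.two_ne_zero hr) hβ0 hβ
    (fun x u => (x.val : ℂ) * χ u)]
  simp only [← Finset.mul_sum, sum_mulChar_of_mul_eq_cube hr χ hχ1 hχ3]
  rw [← ZMod.sum_val, ← Finset.sum_neg_distrib, ← Finset.sum_sub_distrib]
  refine Finset.sum_congr rfl fun x _ => ?_
  split_ifs with h
  · simp [h]
  · ring

section EulerOperator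

variable {R : Type*} [CommRing R]

/-- The Euler operator `X · d/dX` on polynomials. -/
noncomputable def eulerOp (f : R[X]) : R[X] := X * derivative f

theorem eulerOp_iterate_sum_X_pow (s : Finset ℕ) (k : ℕ) :
    eulerOp^[k] (∑ j ∈ s, (X : R[X]) ^ j) = ∑ j ∈ s, C ((j : R) ^ k) * X ^ j := by
  induction k with
  | zero => simp
  | succ k ih =>
    rw [Function.iterate_succ_apply', ih, eulerOp, derivative_sum, Finset.mul_sum]
    refine Finset.sum_congr rfl fun j _ => ?_
    rw [derivative_C_mul_X_pow]
    rcases j with _ | j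
    · simp
    · rw [Nat.add_sub_cancel, pow_succ, pow_succ X]
      ring

theorem eulerOp_iterate_X_sub_one_pow_mul (k n : ℕ) (Q : R[X]) :
    ∃ Q' : R[X], eulerOp^[k] ((X - 1) ^ (n + k) * Q) = (X - 1) ^ n * Q' ∧
      Q'.eval 1 = ((n + 1).ascFactorial k : R) * Q.eval 1 := by
  induction k generalizing Q with
  | zero => exact ⟨Q, by simp, by simp⟩
  | succ k ih =>
    obtain ⟨Q', h1, h2⟩ := ih (C ((n + k + 1 : ℕ) : R) * X * Q + (X - 1) * X * derivative Q)
    refine ⟨Q', ?_, ?_⟩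
    · rw [Function.iterate_succ_apply, ← h1]
      congr 1
      rw [eulerOp, derivative_mul, derivative_pow, ← add_assoc, Nat.add_sub_cancel]
      simp only [derivative_sub, derivative_X, derivative_one, sub_zero, mul_one]
      ring
    · rw [h2, Nat.ascFactorial_succ]
      simp
      ring

theorem exists_eq_X_sub_one_mul (f : R[X]) (hf : f.eval 1 = 0) :
    ∃ q : R[X], f = (X - 1) * q ∧ q.eval 1 = f.derivative.eval 1 := by
  obtain ⟨q, hq⟩ := dvd_iff_isRoot.2 hf
  rw [C_1] at hq
  exact ⟨q, hq, by rw [hq]; simp⟩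

end EulerOperator

theorem geom_sum_X_eq_X_sub_one_pow (p : ℕ) [Fact p.Prime] :
    ∑ j ∈ range p, (X : (ZMod p)[X]) ^ j = (X - 1) ^ (p - 1) := by
  have h : (X - 1 : (ZMod p)[X]) ≠ 0 := by
    rw [← C_1]; exact X_sub_C_ne_zero 1
  refine mul_right_cancel₀ h ?_
  rw [geom_sum_mul, ← pow_succ, Nat.sub_add_cancel (Fact.out : p.Prime).one_le,
    sub_pow_char, one_pow]

theorem ascFactorial_eq_of_X_sub_one_pow_dvd (p m : ℕ) [Fact p.Prime] (hm : p = 2 * m + 1)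
    (hm0 : m ≠ 0) (ε : ZMod p)
    (h : (X - 1 : (ZMod p)[X]) ^ (p - 1) ∣
      (∑ j ∈ range p, C ((j : ZMod p) ^ m) * X ^ j) -
        C ε * ∏ r ∈ Icc 1 m, (X ^ r - X ^ (p - r))) :
    ((m + 1).ascFactorial m : ZMod p) = ε * ∏ r ∈ Icc 1 m, (2 * r : ZMod p) := by
  have hne : (X - 1 : (ZMod p)[X]) ≠ 0 := by
    rw [← C_1]; exact X_sub_C_ne_zero 1
  rw [← eulerOp_iterate_sum_X_pow, geom_sum_X_eq_X_sub_one_pow] at h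
  obtain ⟨Q, hQ1, hQ2⟩ := eulerOp_iterate_X_sub_one_pow_mul (R := ZMod p) m m 1
  have hp1 : p - 1 = m + m := by omega
  rw [mul_one] at hQ1
  rw [hp1, hQ1] at h
  have hq : ∀ r ∈ Icc 1 m, ∃ q : (ZMod p)[X], X ^ r - X ^ (p - r) = (X - 1) * q ∧
      q.eval 1 = 2 * r := by
    intro r hr
    rw [mem_Icc] at hr
    obtain ⟨q, h1, h2⟩ := exists_eq_X_sub_one_mul (X ^ r - X ^ (p - r) : (ZMod p)[X]) (by simp)
    refine ⟨q, h1, ?_⟩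
    rw [h2]
    have : ((p - r : ℕ) : ZMod p) = - r := by
      rw [Nat.cast_sub (by omega)]; simp
    simp [derivative_X_pow, this]
    ring
  choose! q hq1 hq2 using hq
  rw [Finset.prod_congr rfl hq1, Finset.prod_mul_distrib, Finset.prod_const, Nat.card_Icc,
    Nat.add_sub_cancel, pow_add] at h
  have h' : (X - 1 : (ZMod p)[X]) ^ m * (X - 1) ^ m ∣
      (X - 1) ^ m * (Q - C ε * ∏ r ∈ Icc 1 m, q r) := by
    convert h using 1; ring
  have h2 := (dvd_pow_self _ hm0).trans ((mul_dvd_mul_iff_left (pow_ne_zero m hne)).1 h')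
  rw [← C_1, dvd_iff_isRoot, IsRoot, eval_sub, eval_mul, eval_C, eval_prod, hQ2,
    Finset.prod_congr rfl hq2] at h2
  simpa [sub_eq_zero] using h2

theorem half_factorial_sq (p m : ℕ) [Fact p.Prime] (hm : p = 2 * m + 1) (hodd : Odd m) :
    ((m.factorial : ZMod p)) ^ 2 = 1 := by
  have h := ZMod.wilsons_lemma p
  have hp1 : p - 1 = m + m := by omega
  rw [hp1, ← Nat.factorial_mul_ascFactorial, Nat.ascFactorial_eq_prod_range] at h
  have h2 : ((∏ i ∈ range m, (m + 1 + i) : ℕ) : ZMod p) = (-1) ^ m * (m.factorial : ZMod p) := by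
    rw [← Finset.prod_range_reflect, ← Finset.prod_range_add_one_eq_factorial]
    push_cast
    rw [← Finset.card_range m, ← Finset.prod_const, Finset.card_range, ← Finset.prod_mul_distrib]
    refine Finset.prod_congr rfl fun i hi => ?_
    rw [mem_range] at hi
    have : ((m + 1 + (m - 1 - i) + (i + 1) : ℕ) : ZMod p) = 0 := by
      rw [show m + 1 + (m - 1 - i) + (i + 1) = p by omega]; simp
    push_cast at this
    linear_combination this
  push_cast at h h2
  rw [h2, hodd.neg_one_pow] at h
  linear_combination -h

theorem neg_one_eq_of_X_sub_one_pow_dvd (p m : ℕ) [Fact p.Prime] (hm : p = 2 * m + 1)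
    (hodd : Odd m) (ε : ZMod p)
    (h : (X - 1 : (ZMod p)[X]) ^ (p - 1) ∣
      (∑ j ∈ range p, C ((j : ZMod p) ^ m) * X ^ j) -
        C ε * ∏ r ∈ Icc 1 m, (X ^ r - X ^ (p - r))) :
    ε * 2 ^ m = -1 := by
  have h1 := ascFactorial_eq_of_X_sub_one_pow_dvd p m hm hodd.pos.ne' ε h
  have h2 := half_factorial_sq p m hm hodd
  have h3 := ZMod.wilsons_lemma p
  rw [show p - 1 = m + m by omega, ← Nat.factorial_mul_ascFactorial, Nat.cast_mul, h1,
    Finset.prod_mul_distrib, Finset.prod_const, Nat.card_Icc, Nat.add_sub_cancel,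
    ← Nat.cast_prod, ← Finset.Ico_add_one_right_eq_Icc, Finset.prod_Ico_id_eq_factorial] at h3
  linear_combination h3 - ε * 2 ^ m * h2

theorem prod_half_system_sq {ζ : ℂ} {p m : ℕ} (hm : p = 2 * m + 1) (hζ : IsPrimitiveRoot ζ p)
    (hodd : Odd m) : (∏ r ∈ Icc 1 m, (ζ ^ r - ζ ^ (p - r))) ^ 2 = -(p : ℂ) := by
  have hμ : IsPrimitiveRoot (ζ ^ 2) (m + m + 1) := by
    have := hζ.pow_of_coprime 2 (by rw [hm]; simp)
    rwa [show m + m + 1 = p by omega]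
  have h := hμ.prod_one_sub_pow_eq_order
  rw [Finset.prod_range_add, ← Finset.prod_range_reflect (fun x => 1 - (ζ ^ 2) ^ (m + x + 1)),
    ← Finset.prod_mul_distrib] at h
  rw [← Finset.Ico_add_one_right_eq_Icc, Finset.prod_Ico_eq_prod_range, Nat.add_sub_cancel,
    ← Finset.prod_pow]
  have key : ∀ i ∈ range m, (ζ ^ (1 + i) - ζ ^ (p - (1 + i))) ^ 2 =
      -1 * ((1 - (ζ ^ 2) ^ (i + 1)) * (1 - (ζ ^ 2) ^ (m + (m - 1 - i) + 1))) := by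
    intro i hi
    rw [mem_range] at hi
    have e : m + (m - 1 - i) + 1 = p - (1 + i) := by omega
    have e2 : ζ ^ (1 + i) * ζ ^ (p - (1 + i)) = 1 := by
      rw [← pow_add, ← hζ.pow_eq_one]; congr 1; omega
    rw [e, add_comm i 1, ← pow_mul, ← pow_mul, mul_comm 2, mul_comm 2, pow_mul, pow_mul]
    linear_combination (-2 + (ζ ^ (1 + i) * ζ ^ (p - (1 + i)) + 1)) * e2
  rw [Finset.prod_congr rfl key, Finset.prod_mul_distrib, h, Finset.prod_const, card_range,
    hodd.neg_one_pow]
  rw [hm]; push_cast; ring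

theorem prod_half_system_eq {p m : ℕ} (hm : p = 2 * m + 1) :
    ∃ a : ℝ, 0 < a ∧ ∏ r ∈ Icc 1 m, (Complex.exp (2 * Real.pi * Complex.I / p) ^ r -
      Complex.exp (2 * Real.pi * Complex.I / p) ^ (p - r)) = a * Complex.I ^ m := by
  refine ⟨∏ r ∈ Icc 1 m, 2 * Real.sin (2 * Real.pi * r / p), ?_, ?_⟩
  · refine Finset.prod_pos fun r hr => ?_
    rw [mem_Icc] at hr
    have hr0 : (0 : ℝ) < r := by exact_mod_cast hr.1
    have hp : (0 : ℝ) < p := by rw [hm]; positivity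
    refine mul_pos two_pos (Real.sin_pos_of_pos_of_lt_pi (by positivity) ?_)
    rw [div_lt_iff₀ hp]
    have : (2 * r : ℝ) < p := by
      have : 2 * r < p := by omega
      exact_mod_cast this
    nlinarith [Real.pi_pos]
  · rw [← Nat.add_sub_cancel m 1, ← Nat.card_Icc, ← Finset.prod_const, Nat.card_Icc,
      Nat.add_sub_cancel, Complex.ofReal_prod, ← Finset.prod_mul_distrib]
    refine Finset.prod_congr rfl fun r hr => ?_
    rw [mem_Icc] at hr
    have hp : (p : ℂ) ≠ 0 := by rw [hm]; exact_mod_cast Nat.succ_ne_zero (2 * m)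
    have h1 : Complex.exp (2 * Real.pi * Complex.I / p) ^ r =
        Complex.exp ((2 * Real.pi * r / p : ℂ) * Complex.I) := by
      rw [← Complex.exp_nat_mul]; congr 1; ring
    have h2 : Complex.exp (2 * Real.pi * Complex.I / p) ^ (p - r) =
        Complex.exp (-(2 * Real.pi * r / p : ℂ) * Complex.I) := by
      rw [← Complex.exp_nat_mul, Nat.cast_sub (by omega), Complex.exp_eq_exp_iff_exists_int]
      refine ⟨1, ?_⟩
      field_simp
      push_cast
      ring
    rw [h1, h2]
    push_cast
    rw [Complex.sin]
    linear_combination -(Complex.exp (-(2 * Real.pi * r / p : ℂ) * Complex.I) -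
      Complex.exp ((2 * Real.pi * r / p : ℂ) * Complex.I)) * Complex.I_mul_I

theorem gaussSum_quadraticChar_eq (p : ℕ) [Fact p.Prime] (hp : p % 4 = 3) :
    gaussSum ((quadraticChar (ZMod p)).ringHomComp (Int.castRingHom ℂ)) ZMod.stdAddChar
      = Complex.I * (Real.sqrt p : ℂ) := by
  have hP : p.Prime := Fact.out
  obtain ⟨m, hm⟩ : ∃ m, p = 2 * m + 1 := ⟨p / 2, by omega⟩
  have hodd : Odd m := Nat.odd_iff.2 (by omega)
  have hp2 : p ≠ 2 := by omega
  have hr : ringChar (ZMod p) ≠ 2 := by rwa [ZMod.ringChar_zmod_n]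
  set χ := (quadraticChar (ZMod p)).ringHomComp (Int.castRingHom ℂ) with hχ
  set ζ : ℂ := Complex.exp (2 * Real.pi * Complex.I / p) with hζdef
  have hζ : IsPrimitiveRoot ζ p := Complex.isPrimitiveRoot_exp p hP.ne_zero
  set G := gaussSum χ (ZMod.stdAddChar (N := p)) with hG
  have hGsum : G = ∑ j ∈ range p, (quadraticChar (ZMod p) j : ℂ) * ζ ^ j := by
    obtain ⟨n, hn⟩ : ∃ n, p = n + 1 := ⟨p - 1, by omega⟩
    have hψ : ∀ a : ZMod p, ZMod.stdAddChar a = ζ ^ a.val := by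
      intro a
      have h := ZMod.stdAddChar_coe (N := p) (a.val : ℤ)
      rw [Int.cast_natCast, ZMod.natCast_zmod_val] at h
      rw [h, hζdef, ← Complex.exp_nat_mul]
      congr 1
      push_cast
      ring
    rw [hG, gaussSum, Finset.sum_range]
    simp only [hψ]
    subst hn
    refine Finset.sum_congr rfl fun a _ => ?_
    change (quadraticChar (ZMod (n + 1)) a : ℂ) * _ = _
    congr 3
    exact (ZMod.natCast_zmod_val (n := n + 1) a).symm
  have hsq : G ^ 2 = -(p : ℂ) := by
    have hne : χ ≠ 1 := by
      rw [hχ, Ne, MulChar.ringHomComp_eq_one_iff (Int.castRingHom ℂ).injective_int]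
      exact quadraticChar_ne_one hr
    rw [hG, gaussSum_sq hne ((quadraticChar_isQuadratic _).comp _) (ZMod.isPrimitive_stdAddChar p),
      hχ, MulChar.ringHomComp_apply, quadraticChar_neg_one hr, ZMod.card,
      ZMod.χ₄_nat_three_mod_four hp]
    simp
  set P : ℂ := ∏ r ∈ Icc 1 m, (ζ ^ r - ζ ^ (p - r)) with hPdef
  have hPsq : P ^ 2 = -(p : ℂ) := prod_half_system_sq hm hζ hodd
  obtain ⟨a, ha, haP⟩ := prod_half_system_eq hm
  rw [← hζdef, ← hPdef] at haP
  obtain ⟨ε, hε, hGP⟩ : ∃ ε : ℤ, (ε = 1 ∨ ε = -1) ∧ G = ε * P := by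
    rcases sq_eq_sq_iff_eq_or_eq_neg.1 (hsq.trans hPsq.symm) with h | h
    · exact ⟨1, Or.inl rfl, by simpa using h⟩
    · exact ⟨-1, Or.inr rfl, by simpa using h⟩
  have hdvd : cyclotomic p ℤ ∣ (∑ j ∈ range p, C (quadraticChar (ZMod p) j) * X ^ j) -
      C ε * ∏ r ∈ Icc 1 m, (X ^ r - X ^ (p - r)) := by
    rw [cyclotomic_eq_minpoly hζ hP.pos]
    refine minpoly.isIntegrallyClosed_dvd (hζ.isIntegral hP.pos) ?_
    rw [map_sub, map_sum, map_mul, map_prod]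
    simp only [map_mul, map_sub, map_pow, aeval_X, eq_intCast, map_intCast]
    rw [← hGsum, ← hPdef, hGP, sub_self]
  have hdvd' := Polynomial.map_dvd (Int.castRingHom (ZMod p)) hdvd
  rw [map_cyclotomic, cyclotomic_prime, geom_sum_X_eq_X_sub_one_pow] at hdvd'
  have hεm : ((ε : ZMod p)) * 2 ^ m = -1 := by
    refine neg_one_eq_of_X_sub_one_pow_dvd p m hm hodd ε ?_
    convert hdvd' using 1
    rw [Polynomial.map_sub, Polynomial.map_sum, Polynomial.map_mul, Polynomial.map_prod]
    congr 1
    · refine Finset.sum_congr rfl fun j _ => ?_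
      rw [Polynomial.map_mul, Polynomial.map_C, Polynomial.map_pow, Polynomial.map_X, eq_intCast,
        quadraticChar_eq_pow_of_char_ne_two' hr, ZMod.card, show p / 2 = m by omega]
    · simp
  have h2m : (2 : ZMod p) ^ m = (ZMod.χ₈ (p : ZMod 8) : ℤ) := by
    have h := quadraticChar_eq_pow_of_char_ne_two' hr (2 : ZMod p)
    rw [ZMod.card, show p / 2 = m by omega] at h
    rw [← h, quadraticChar_two hr, ZMod.card]
  have h11 : (1 : ZMod p) ≠ -1 := fun h => Ring.neg_one_ne_one_of_char_ne_two hr h.symm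
  have hεI : (ε : ℂ) * Complex.I ^ m = Complex.I := by
    have h8 : p % 8 = 3 ∨ p % 8 = 7 := by omega
    have hcast : (p : ZMod 8) = ((p % 8 : ℕ) : ZMod 8) := (ZMod.natCast_mod p 8).symm
    rcases h8 with h8 | h8
    · have hχ8 : ZMod.χ₈ (p : ZMod 8) = -1 := by rw [hcast, h8]; decide
      rw [h2m, hχ8] at hεm
      obtain rfl : ε = 1 := by
        rcases hε with rfl | rfl
        · rfl
        · exact absurd (by simpa using hεm) h11
      obtain ⟨k, hk⟩ : ∃ k, m = 4 * k + 1 := ⟨m / 4, by omega⟩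
      rw [hk, pow_succ, pow_mul, Complex.I_pow_four]
      simp
    · have hχ8 : ZMod.χ₈ (p : ZMod 8) = 1 := by rw [hcast, h8]; decide
      rw [h2m, hχ8] at hεm
      obtain rfl : ε = -1 := by
        rcases hε with rfl | rfl
        · exact absurd (by simpa using hεm) h11
        · rfl
      obtain ⟨k, hk⟩ : ∃ k, m = 4 * k + 3 := ⟨m / 4, by omega⟩
      rw [hk, pow_add, pow_mul, Complex.I_pow_four, Complex.I_pow_three]
      simp
  have hGa : G = a * Complex.I := by
    rw [hGP, haP]
    linear_combination (a : ℂ) * hεI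
  have hasq : a ^ 2 = p := by
    rw [hGa, mul_pow, Complex.I_sq] at hsq
    have : ((a ^ 2 : ℝ) : ℂ) = ((p : ℝ) : ℂ) := by
      push_cast
      linear_combination -hsq
    exact_mod_cast this
  rw [hGa, ← hasq, Real.sqrt_sq ha.le, mul_comm]

lemma abs_one_div_rpow_sub_le {n : ℕ} (hn : 1 ≤ n) {s x y : ℝ} (hs : 1 ≤ s) (hs2 : s ≤ 2)
    (hx : x ∈ Set.Icc (n : ℝ) (n + 1)) (hy : y ∈ Set.Icc (n : ℝ) (n + 1)) :
    |1 / x ^ s - 1 / y ^ s| ≤ 2 / (n : ℝ) ^ 2 := by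
  have hn0 : (1 : ℝ) ≤ n := by exact_mod_cast hn
  have key : ∀ z ∈ Set.Icc (n : ℝ) (n + 1),
      1 / ((n : ℝ) + 1) ^ s ≤ 1 / z ^ s ∧ 1 / z ^ s ≤ 1 / (n : ℝ) ^ s := fun z hz ↦
    ⟨one_div_le_one_div_of_le (Real.rpow_pos_of_pos (by linarith [hz.1]) _)
      (Real.rpow_le_rpow (by linarith [hz.1]) hz.2 (by linarith)),
     one_div_le_one_div_of_le (Real.rpow_pos_of_pos (by linarith) _)
      (Real.rpow_le_rpow (by linarith) hz.1 (by linarith))⟩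
  have hmain : 1 / (n : ℝ) ^ s - 1 / ((n : ℝ) + 1) ^ s ≤ 2 / (n : ℝ) ^ 2 := by
    have hb := one_add_mul_self_le_rpow_one_add (s := -(1 / ((n : ℝ) + 1))) (p := s)
      (by rw [neg_le_neg_iff, div_le_one (by linarith)]; linarith) hs
    have he : 1 + -(1 / ((n : ℝ) + 1)) = n / (n + 1) := by field_simp; ring
    rw [he, Real.div_rpow (by linarith) (by linarith)] at hb
    have hpos : 0 < (n : ℝ) ^ s := Real.rpow_pos_of_pos (by linarith) _
    have h1 : (n : ℝ) ≤ (n : ℝ) ^ s := Real.self_le_rpow_of_one_le hn0 hs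
    have h2 : 1 / (n : ℝ) ^ s - 1 / ((n : ℝ) + 1) ^ s
        = 1 / (n : ℝ) ^ s * (1 - (n : ℝ) ^ s / ((n : ℝ) + 1) ^ s) := by field_simp
    have h3 : 1 - (n : ℝ) ^ s / ((n : ℝ) + 1) ^ s ≤ 2 / n := by
      have h5 : s * (1 / ((n : ℝ) + 1)) ≤ 2 * (1 / n) := by
        gcongr
        linarith
      rw [mul_one_div 2] at h5
      linarith
    have h4 : 1 / (n : ℝ) ^ s ≤ 1 / n := one_div_le_one_div_of_le (by linarith) h1
    calc _ = _ := h2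
      _ ≤ 1 / (n : ℝ) ^ s * (2 / n) := by gcongr
      _ ≤ 1 / n * (2 / n) := by gcongr
      _ = _ := by field_simp
  rw [abs_le]
  constructor <;> linarith [key x hx, key y hy]

open Filter Topology HurwitzZeta in
lemma hurwitzZetaOdd_one {a : ℝ} (ha0 : 0 < a) (ha1 : a < 1) :
    hurwitzZetaOdd (a : UnitAddCircle) 1 = Real.pi / 2 * Complex.cot (Real.pi * a) := by
  set f : ℝ → ℕ → ℝ := fun s n ↦ (1 / (n + a) ^ s - 1 / (n + 1 - a) ^ s) / 2 with hf
  set bd : ℕ → ℝ := fun n ↦ if n = 0 then 1 / a ^ 2 + 1 / (1 - a) ^ 2 else 1 / (n : ℝ) ^ 2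
    with hbd
  have hsbd : Summable bd := by
    refine ((Real.summable_one_div_nat_pow (p := 2)).mpr one_lt_two).congr_cofinite ?_
    rw [Nat.cofinite_eq_atTop]
    filter_upwards [eventually_ne_atTop 0] with n hn
    simp [hbd, hn]
  have hfbd : ∀ s ∈ Set.Icc (1 : ℝ) 2, ∀ n, ‖f s n‖ ≤ bd n := by
    intro s hs n
    rcases Nat.eq_zero_or_pos n with rfl | hn
    · simp only [hf, hbd, if_true, Nat.cast_zero, zero_add, Real.norm_eq_abs]
      have key : ∀ z : ℝ, 0 < z → z < 1 → 0 ≤ 1 / z ^ s ∧ 1 / z ^ s ≤ 1 / z ^ 2 := by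
        intro z h0 h1
        refine ⟨by positivity, one_div_le_one_div_of_le (by positivity) ?_⟩
        rw [← Real.rpow_natCast]
        exact Real.rpow_le_rpow_of_exponent_ge h0 h1.le (by exact_mod_cast hs.2)
      have k1 := key a ha0 ha1
      have k2 := key (1 - a) (by linarith) (by linarith)
      rw [abs_le]
      constructor <;> linarith
    · have := abs_one_div_rpow_sub_le hn hs.1 hs.2 (x := n + a) (y := n + 1 - a)
        ⟨by linarith, by linarith⟩ ⟨by linarith, by linarith⟩
      simp only [hf, hbd, hn.ne', if_false, Real.norm_eq_abs, abs_div, abs_two]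
      rw [div_le_iff₀ two_pos]
      calc _ ≤ _ := this
        _ = _ := by ring
  have hlim : Tendsto (fun s : ℝ ↦ ∑' n, f s n) (𝓝[>] 1) (𝓝 (∑' n, f 1 n)) := by
    refine tendsto_tsum_of_dominated_convergence hsbd (fun n ↦ ?_) ?_
    · refine tendsto_nhdsWithin_of_tendsto_nhds (ContinuousAt.tendsto ?_)
      have h1 : (0 : ℝ) < n + a := by positivity
      have h2 : (0 : ℝ) < n + 1 - a := by linarith [Nat.cast_nonneg (α := ℝ) n]
      refine ContinuousAt.div_const (ContinuousAt.sub ?_ ?_) 2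
      · exact continuousAt_const.div (Real.continuousAt_const_rpow h1.ne')
          (Real.rpow_pos_of_pos h1 _).ne'
      · exact continuousAt_const.div (Real.continuousAt_const_rpow h2.ne')
          (Real.rpow_pos_of_pos h2 _).ne'
    · filter_upwards [Ioc_mem_nhdsGT one_lt_two] with s hs
      exact hfbd s ⟨hs.1.le, hs.2⟩
  have hval : ∀ s : ℝ, 1 < s → hurwitzZetaOdd (a : UnitAddCircle) s = ((∑' n, f s n : ℝ) : ℂ) := by
    intro s hs
    have := hasSum_nat_hurwitzZetaOdd_of_mem_Icc (a := a) ⟨ha0.le, ha1.le⟩ (s := s)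
      (by simpa using hs)
    rw [← this.tsum_eq, Complex.ofReal_tsum]
    congr 1
    ext n
    simp only [hf]
    have h1 : (0 : ℝ) ≤ n + a := by positivity
    have h2 : (0 : ℝ) ≤ n + 1 - a := by linarith [Nat.cast_nonneg (α := ℝ) n]
    push_cast [Complex.ofReal_cpow h1, Complex.ofReal_cpow h2]
    rfl
  have hlim2 : Tendsto (fun s : ℝ ↦ hurwitzZetaOdd (a : UnitAddCircle) s) (𝓝[>] 1)
      (𝓝 (hurwitzZetaOdd (a : UnitAddCircle) 1)) := by
    have hc : Continuous fun s : ℝ ↦ hurwitzZetaOdd (a : UnitAddCircle) s :=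
      (differentiable_hurwitzZetaOdd _).continuous.comp Complex.continuous_ofReal
    have := hc.tendsto 1
    rw [Complex.ofReal_one] at this
    exact tendsto_nhdsWithin_of_tendsto_nhds this
  have h1 : hurwitzZetaOdd (a : UnitAddCircle) 1 = ((∑' n, f 1 n : ℝ) : ℂ) := by
    refine tendsto_nhds_unique hlim2 ?_
    refine ((Complex.continuous_ofReal.tendsto _).comp hlim).congr' ?_
    filter_upwards [self_mem_nhdsWithin] with s hs
    exact (hval s hs).symm
  have hs1 : Summable (f 1) := Summable.of_norm_bounded hsbd (hfbd 1 (by norm_num))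
  have hZ : (a : ℂ) ∈ Complex.integerComplement := by
    rintro ⟨m, hm⟩
    have hm' : (m : ℝ) = a := by exact_mod_cast hm
    rw [← hm'] at ha0 ha1
    have h0 : 0 < m := by exact_mod_cast ha0
    have h1 : m < 1 := by exact_mod_cast ha1
    omega
  have hpart : ∀ N : ℕ, ((∑ n ∈ range N, f 1 n : ℝ) : ℂ)
      = (1 / a + ∑ n ∈ range N, cotTerm a n - 1 / (N + a)) / 2 := by
    intro N
    have hz : ∀ m : ℤ, (a : ℂ) + m ≠ 0 := fun m h ↦ by
      exact hZ ⟨-m, by push_cast; linear_combination -h⟩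
    induction N with
    | zero => simp
    | succ N ih =>
      rw [sum_range_succ, sum_range_succ, Complex.ofReal_add, ih]
      simp only [hf, cotTerm, Real.rpow_one]
      push_cast
      have e1 : (N : ℂ) + a ≠ 0 := by have := hz N; push_cast at this; rwa [add_comm]
      have e2 : (N : ℂ) + 1 + a ≠ 0 := by
        have := hz (N + 1); push_cast at this; rwa [add_comm]
      have e3 : (N : ℂ) + 1 - a ≠ 0 := by
        have := hz (-(N + 1)); push_cast at this; contrapose! this; linear_combination -this
      have e4 : (a : ℂ) - (N + 1) ≠ 0 := by
        contrapose! e3; linear_combination -e3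
      have e5 : (a : ℂ) + (N + 1) ≠ 0 := by
        contrapose! e2; linear_combination e2
      have e6 : (a : ℂ) ≠ 0 := by exact_mod_cast ha0.ne'
      have e7 : 1 / ((a : ℂ) - (N + 1)) = - (1 / ((N : ℂ) + 1 - a)) := by
        rw [← neg_sub, one_div_neg_eq_neg_one_div]
      rw [e7, add_comm (a : ℂ) (N + 1)]
      ring
  have hlim3 : Tendsto (fun N : ℕ ↦ ((∑ n ∈ range N, f 1 n : ℝ) : ℂ)) atTop
      (𝓝 (Real.pi / 2 * Complex.cot (Real.pi * a))) := by
    simp_rw [hpart]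
    have t1 := tendsto_logDeriv_euler_cot_sub hZ
    have t2 : Tendsto (fun N : ℕ ↦ (1 / (N + a) : ℂ)) atTop (𝓝 0) := by
      have : Tendsto (fun N : ℕ ↦ ((1 / (N + a) : ℝ) : ℂ)) atTop (𝓝 ((0 : ℝ) : ℂ)) := by
        refine (Complex.continuous_ofReal.tendsto _).comp ?_
        simp only [one_div]
        exact (tendsto_atTop_add_const_right _ a tendsto_natCast_atTop_atTop).inv_tendsto_atTop
      simpa using this
    convert (((tendsto_const_nhds (x := (1 / a : ℂ))).add t1).sub t2).div_const 2 using 2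
    ring
  rw [h1]
  exact tendsto_nhds_unique
    ((Complex.continuous_ofReal.tendsto _).comp hs1.hasSum.tendsto_sum_nat) hlim3

open Filter Topology HurwitzZeta in
lemma LFunction_one_of_odd {N : ℕ} [NeZero N] {Φ : ZMod N → ℂ} (hΦ : Φ.Odd) :
    ZMod.LFunction Φ 1
      = Real.pi / (2 * N) * ∑ j : ZMod N, Φ j * Complex.cot (Real.pi * (j.val / N)) := by
  have hN : (N : ℂ) ≠ 0 := NeZero.ne _
  rw [ZMod.LFunction_def_odd hΦ, Complex.cpow_neg_one, mul_sum, mul_sum]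
  refine sum_congr rfl fun j _ ↦ ?_
  by_cases hj : j = 0
  · have : Φ 0 = 0 := by
      have := hΦ 0
      rw [neg_zero] at this
      exact self_eq_neg.mp this
    simp [hj, this]
  · have hpos : 0 < j.val := Nat.pos_of_ne_zero fun h ↦ hj ((ZMod.val_eq_zero j).mp h)
    have hlt := ZMod.val_lt j
    have hNr : (0 : ℝ) < N := Nat.cast_pos.mpr (hpos.trans hlt)
    have := hurwitzZetaOdd_one (a := (j.val : ℝ) / N) (by positivity)
      ((div_lt_one hNr).mpr (by exact_mod_cast hlt))
    rw [ZMod.toAddCircle_apply, this]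
    push_cast
    field_simp

/-- The discrete Fourier transform of the sawtooth function. -/
lemma sum_val_mul_stdAddChar {N : ℕ} [NeZero N] {k : ZMod N} (hk : k ≠ 0) :
    ∑ a : ZMod N, (a.val : ℂ) * ZMod.stdAddChar (a * k) * 2
      = - N - N * Complex.I * Complex.cot (Real.pi * (k.val / N)) := by
  have hN : (N : ℂ) ≠ 0 := NeZero.ne _
  set z : ℂ := ZMod.stdAddChar k with hz
  have hz1 : z ≠ 1 := by
    intro h
    apply hk
    have := ZMod.injective_stdAddChar (N := N)
    apply this
    rw [← hz, h, AddChar.map_zero_eq_one]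
  have hzN : z ^ N = 1 := by
    rw [hz, ← AddChar.map_nsmul_eq_pow]
    simp
  have hsum : ∑ a : ZMod N, (a.val : ℂ) * ZMod.stdAddChar (a * k)
      = ∑ i ∈ range N, (i : ℂ) * z ^ i := by
    rw [← sum_nbij (s := (univ : Finset (ZMod N))) (fun a ↦ a.val)
      (fun a _ ↦ by simpa using ZMod.val_lt a)
      (fun a _ b _ h ↦ ZMod.val_injective N h)
      (fun i hi ↦ ⟨(i : ZMod N), by simp, ZMod.val_cast_of_lt (by simpa using hi)⟩)
      (fun a _ ↦ ?_)]
    rw [hz, ← AddChar.map_nsmul_eq_pow]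
    simp
  have hgeom : ∀ n : ℕ, (z - 1) * ∑ i ∈ range n, (i : ℂ) * z ^ i
      = n * z ^ n - ∑ i ∈ range n, z ^ (i + 1) := by
    intro n
    induction n with
    | zero => simp
    | succ n ih =>
      rw [sum_range_succ, mul_add, ih, sum_range_succ]
      push_cast
      ring
  have hg0 : ∑ i ∈ range N, z ^ (i + 1) = 0 := by
    have := mul_geom_sum z N
    rw [hzN, sub_self, mul_eq_zero] at this
    rw [← mul_zero z, ← this.resolve_left (sub_ne_zero.mpr hz1), mul_sum]
    exact sum_congr rfl fun i _ ↦ pow_succ' z i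
  have hm := hgeom N
  rw [hzN, hg0, ← hsum] at hm
  have hcot : Complex.cot (Real.pi * (k.val / N)) = (z + 1) / (Complex.I * (1 - z)) := by
    have hzexp : z = Complex.exp (2 * Real.pi * Complex.I * (k.val / N)) := by
      have := ZMod.stdAddChar_coe (N := N) (k.val : ℤ)
      rw [Int.cast_natCast, Int.cast_natCast, ZMod.natCast_zmod_val] at this
      rw [hz, this]
      congr 1
      ring
    rw [Complex.cot_pi_eq_exp_ratio, hzexp]
  rw [hcot, ← sum_mul]
  have h1 : z - 1 ≠ 0 := sub_ne_zero.mpr hz1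
  have h2 : 1 - z ≠ 0 := sub_ne_zero.mpr (Ne.symm hz1)
  have hm' : ∑ a : ZMod N, (a.val : ℂ) * ZMod.stdAddChar (a * k) = N / (z - 1) := by
    rw [eq_div_iff h1]; linear_combination hm
  rw [hm']
  have hI := Complex.I_ne_zero
  field_simp
  ring

lemma LFunction_quadraticChar_one {p : ℕ} [Fact p.Prime] (hp : p % 4 = 3)
    (hτ : gaussSum ((quadraticChar (ZMod p)).ringHomComp (Int.castRingHom ℂ)) ZMod.stdAddChar
      = Complex.I * (Real.sqrt p : ℂ)) :
    ZMod.LFunction (fun x : ZMod p ↦ (quadraticChar (ZMod p) x : ℂ)) 1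
      = - Real.pi / (p * Real.sqrt p) * ∑ x : ZMod p, (x.val : ℂ) * (quadraticChar (ZMod p) x : ℂ) := by
  have hp0 : (p : ℂ) ≠ 0 := NeZero.ne _
  set χ : MulChar (ZMod p) ℂ := (quadraticChar (ZMod p)).ringHomComp (Int.castRingHom ℂ) with hχ
  have hχe : ∀ x, (quadraticChar (ZMod p) x : ℂ) = χ x := fun x ↦ by
    simp [hχ, MulChar.ringHomComp_apply]
  have hr : ringChar (ZMod p) ≠ 2 := by rw [ZMod.ringChar_zmod_n]; rintro rfl; omega
  have hodd : quadraticChar (ZMod p) (-1) = -1 := by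
    rw [quadraticChar_neg_one hr, ZMod.card, ZMod.χ₄_nat_three_mod_four hp]
  have hΦ : (fun x : ZMod p ↦ χ x).Odd := by
    intro x
    change χ (-x) = - χ x
    rw [← neg_one_mul, map_mul, ← hχe (-1), hodd]
    simp
  have hχ1 : χ ≠ 1 := by
    intro h
    have h2 : χ (-1) = 1 := by rw [h]; exact MulChar.one_apply (isUnit_one.neg)
    rw [← hχe, hodd] at h2
    norm_num at h2
  have hsum0 : ∑ x, χ x = 0 := MulChar.sum_eq_zero_of_ne_one hχ1
  have hχ0 : χ 0 = 0 := MulChar.map_zero χ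
  have hshift : ∀ a : ZMod p,
      ∑ k, χ k * ZMod.stdAddChar (a * k) = χ a * gaussSum χ ZMod.stdAddChar := by
    intro a
    rcases eq_or_ne a 0 with rfl | ha
    · simp [hsum0, hχ0]
    · have hm := gaussSum_mulShift χ ZMod.stdAddChar (Units.mk0 a ha)
      have hsq : χ a * χ a = 1 := by
        rw [← hχe, ← Int.cast_mul, ← pow_two, quadraticChar_sq_one ha, Int.cast_one]
      simp only [Units.val_mk0] at hm
      rw [← hm, ← mul_assoc, hsq, one_mul]
      simp [gaussSum, AddChar.mulShift_apply]
  have hdouble : (∑ x : ZMod p, (x.val : ℂ) * χ x) * (gaussSum χ ZMod.stdAddChar) * 2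
      = - p * Complex.I * ∑ j : ZMod p, χ j * Complex.cot (Real.pi * (j.val / p)) := by
    calc _ = ∑ x : ZMod p, ∑ k, χ k * ((x.val : ℂ) * ZMod.stdAddChar (x * k) * 2) := by
          rw [mul_assoc, sum_mul]
          refine sum_congr rfl fun x _ ↦ ?_
          rw [mul_assoc, ← mul_assoc (χ x), ← hshift, sum_mul, mul_sum]
          exact sum_congr rfl fun k _ ↦ by ring
      _ = ∑ k, χ k * (- p - p * Complex.I * Complex.cot (Real.pi * (k.val / p))) := by
          rw [sum_comm]
          refine sum_congr rfl fun k _ ↦ ?_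
          rw [← mul_sum]
          rcases eq_or_ne k 0 with rfl | hk
          · simp [hχ0]
          · rw [sum_val_mul_stdAddChar hk]
      _ = (- p) * ∑ k, χ k +
            - p * Complex.I * ∑ j : ZMod p, χ j * Complex.cot (Real.pi * (j.val / p)) := by
          rw [mul_sum, mul_sum, ← sum_add_distrib]
          exact sum_congr rfl fun k _ ↦ by ring
      _ = _ := by rw [hsum0, mul_zero, zero_add]
  simp_rw [hχe]
  rw [LFunction_one_of_odd hΦ]
  rw [hτ] at hdouble
  have hsp : (Real.sqrt p : ℂ) ^ 2 = p := by
    rw [← Complex.ofReal_pow, Real.sq_sqrt (Nat.cast_nonneg _), Complex.ofReal_natCast]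
  have hs0 : (Real.sqrt p : ℂ) ≠ 0 := by
    intro h; rw [h] at hsp; apply hp0; rw [← hsp]; ring
  have hc : ∑ j : ZMod p, χ j * Complex.cot (Real.pi * (j.val / p))
      = - 2 * (Real.sqrt p) * (∑ x : ZMod p, (x.val : ℂ) * χ x) / p := by
    rw [eq_div_iff hp0]
    have hI := Complex.I_mul_I
    linear_combination (-Complex.I) * hdouble
      + (2 * (Real.sqrt p) * (∑ x : ZMod p, (x.val : ℂ) * χ x)
        + p * ∑ j : ZMod p, χ j * Complex.cot (Real.pi * (j.val / p))) * hI
  rw [hc]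
  field_simp
  linear_combination (-(∑ x : ZMod p, (x.val : ℂ) * χ x) * 1) * hsp

section IdealCount

variable {R : Type*} [CommRing R] [IsDedekindDomain R] [Module.Free ℤ R]

lemma Ideal.mul_sup_span_natCast_eq {J J' : Ideal R} {m n : ℕ} (hmn : m.Coprime n)
    (hJ : J.absNorm = m) (hJ' : J'.absNorm = n) : J * J' ⊔ Ideal.span {(m : R)} = J := by
  have hm : (m : R) ∈ J := hJ ▸ J.absNorm_mem
  have hn : (n : R) ∈ J' := hJ' ▸ J'.absNorm_mem
  have htop : J' ⊔ Ideal.span {(m : R)} = ⊤ := by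
    rw [← Ideal.isCoprime_iff_sup_eq, Ideal.isCoprime_iff_exists]
    obtain ⟨a, b, hab⟩ := (Nat.isCoprime_iff_coprime.mpr hmn)
    refine ⟨b * n, J'.mul_mem_left _ hn, a * m,
      Ideal.mul_mem_left _ _ (Ideal.mem_span_singleton_self _), ?_⟩
    have := congrArg (Int.cast : ℤ → R) hab
    push_cast at this
    linear_combination this
  apply le_antisymm
  · exact sup_le Ideal.mul_le_left (by simpa [Ideal.span_le] using hm)
  · calc J = J * (J' ⊔ Ideal.span {(m : R)}) := by rw [htop, Ideal.mul_top]
      _ = J * J' ⊔ J * Ideal.span {(m : R)} := Ideal.mul_sup _ _ _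
      _ ≤ _ := sup_le_sup_left Ideal.mul_le_right _

lemma Ideal.dvd_span_pow_of_absNorm_eq {I : Ideal R} {q k : ℕ} (hI : I.absNorm = q ^ k) :
    I ∣ Ideal.span {(q : R)} ^ k := by
  rw [Ideal.dvd_iff_le, Ideal.span_singleton_pow, Ideal.span_singleton_le_iff_mem, ← Nat.cast_pow,
    ← hI]
  exact I.absNorm_mem

lemma Ideal.card_absNorm_eq_pow_of_ramified {q : ℕ} (hq : q.Prime) {P : Ideal R} (hP : Prime P)
    (hPN : P.absNorm = q) (hP2 : P ^ 2 = Ideal.span {(q : R)}) (k : ℕ) :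
    Nat.card {I : Ideal R // I.absNorm = q ^ k} = 1 := by
  have key : ∀ I : Ideal R, I.absNorm = q ^ k → I = P ^ k := by
    intro I hI
    have h := Ideal.dvd_span_pow_of_absNorm_eq hI
    rw [← hP2, ← pow_mul] at h
    obtain ⟨j, -, hj⟩ := (dvd_prime_pow hP _).mp h
    rw [associated_iff_eq] at hj
    rw [hj, map_pow, hPN] at hI
    rw [hj, Nat.pow_right_injective hq.two_le hI]
  rw [Nat.card_eq_one_iff_unique]
  exact ⟨⟨fun I J ↦ Subtype.ext ((key I I.2).trans (key J J.2).symm)⟩, ⟨P ^ k, by rw [map_pow, hPN]⟩⟩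

lemma Ideal.card_absNorm_eq_pow_of_split {q : ℕ} (hq : q.Prime) {P P' : Ideal R} (hP : Prime P)
    (hP' : Prime P') (hne : P ≠ P') (hPN : P.absNorm = q) (hPN' : P'.absNorm = q)
    (hPP : P * P' = Ideal.span {(q : R)}) (k : ℕ) :
    Nat.card {I : Ideal R // I.absNorm = q ^ k} = k + 1 := by
  have hinj : ∀ i j : ℕ, i < j → j ≤ k → P ^ i * P' ^ (k - i) ≠ P ^ j * P' ^ (k - j) := by
    intro i j hij hjk h
    obtain ⟨d, rfl⟩ := Nat.exists_eq_add_of_lt hij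
    rw [show i + d + 1 = i + (d + 1) by ring, pow_add, mul_assoc] at h
    have h1 := mul_left_cancel₀ (pow_ne_zero i hP.ne_zero) h
    have h2 : P ∣ P' ^ (k - i) := by
      rw [h1, pow_succ', mul_assoc]
      exact dvd_mul_right _ _
    exact hne (associated_iff_eq.mp ((hP.dvd_prime_iff_associated hP').mp (hP.dvd_of_dvd_pow h2)))
  have hbij : Function.Bijective (fun i : Fin (k + 1) ↦ (⟨P ^ (i : ℕ) * P' ^ (k - i), by
      rw [map_mul, map_pow, map_pow, hPN, hPN', ← pow_add, Nat.add_sub_cancel' (by omega)]⟩ :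
        {I : Ideal R // I.absNorm = q ^ k})) := by
    constructor
    · intro i j h
      have h : P ^ (i : ℕ) * P' ^ (k - i) = P ^ (j : ℕ) * P' ^ (k - j) := congrArg Subtype.val h
      rcases lt_trichotomy i j with hij | hij | hij
      · exact absurd h (hinj _ _ hij (by omega))
      · exact hij
      · exact absurd h.symm (hinj _ _ hij (by omega))
    · rintro ⟨I, hI⟩
      have h := Ideal.dvd_span_pow_of_absNorm_eq hI
      rw [← hPP, mul_pow] at h
      obtain ⟨A, B, hA, hB, hAB⟩ := exists_dvd_and_dvd_of_dvd_mul h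
      obtain ⟨i, -, hi⟩ := (dvd_prime_pow hP _).mp hA
      obtain ⟨j, -, hj⟩ := (dvd_prime_pow hP' _).mp hB
      rw [associated_iff_eq] at hi hj
      have hN := hI
      rw [hAB, hi, hj, map_mul, map_pow, map_pow, hPN, hPN', ← pow_add] at hN
      have hij := Nat.pow_right_injective hq.two_le hN
      refine ⟨⟨i, by omega⟩, Subtype.ext ?_⟩
      simp only
      rw [hAB, hi, hj, ← hij, Nat.add_sub_cancel_left]
  rw [← Nat.card_congr (Equiv.ofBijective _ hbij), Nat.card_fin]

variable [Module.Finite ℤ R]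

lemma Ideal.exists_mul_eq_of_absNorm_eq_mul {I : Ideal R} {m n : ℕ} (hm : m ≠ 0) (hn : n ≠ 0)
    (hmn : m.Coprime n) (hI : I.absNorm = m * n) :
    ∃ J J' : Ideal R, J.absNorm = m ∧ J'.absNorm = n ∧ J * J' = I := by
  set J := I ⊔ Ideal.span {(m : R)} with hJ
  set J' := I ⊔ Ideal.span {(n : R)} with hJ'
  have hmJ : (m : R) ∈ J := le_sup_right (a := I) (Ideal.mem_span_singleton_self _)
  have hnJ : (n : R) ∈ J' := le_sup_right (a := I) (Ideal.mem_span_singleton_self _)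
  have hcop : IsCoprime J J' := by
    rw [Ideal.isCoprime_iff_exists]
    obtain ⟨a, b, hab⟩ := (Nat.isCoprime_iff_coprime.mpr hmn)
    refine ⟨a * m, J.mul_mem_left _ hmJ, b * n, J'.mul_mem_left _ hnJ, ?_⟩
    exact_mod_cast congrArg (Int.cast : ℤ → R) hab
  have hmul : J * J' = I := by
    apply le_antisymm
    · rw [hJ, hJ', Ideal.sup_mul, Ideal.mul_sup, Ideal.mul_sup]
      refine sup_le (sup_le Ideal.mul_le_left Ideal.mul_le_left)
        (sup_le Ideal.mul_le_right ?_)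
      rw [Ideal.span_singleton_mul_span_singleton, Ideal.span_singleton_le_iff_mem, ← Nat.cast_mul, ← hI]
      exact I.absNorm_mem
    · rw [Ideal.mul_eq_inf_of_isCoprime hcop]
      exact le_inf le_sup_left le_sup_left
  have hN : J.absNorm * J'.absNorm = m * n := by rw [← map_mul, hmul, hI]
  have h1 : J.absNorm ∣ m := by
    have h : J.absNorm ∣ m ^ Module.finrank ℤ R := by
      rw [← Ideal.absNorm_span_natCast]
      exact Ideal.absNorm_dvd_absNorm_of_le le_sup_right
    exact ((hmn.pow_left _).coprime_dvd_left h).dvd_of_dvd_mul_right (hN ▸ dvd_mul_right _ _)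
  have h2 : J'.absNorm ∣ n := by
    have h : J'.absNorm ∣ n ^ Module.finrank ℤ R := by
      rw [← Ideal.absNorm_span_natCast]
      exact Ideal.absNorm_dvd_absNorm_of_le le_sup_right
    exact ((hmn.symm.pow_left _).coprime_dvd_left h).dvd_of_dvd_mul_left (hN ▸ dvd_mul_left _ _)
  have h3 := Nat.le_of_dvd (Nat.pos_of_ne_zero hm) h1
  have h4 := Nat.le_of_dvd (Nat.pos_of_ne_zero hn) h2
  have hm' := Nat.pos_of_ne_zero hm
  have hn' := Nat.pos_of_ne_zero hn
  have hpos : 0 < J.absNorm := Nat.pos_of_dvd_of_pos h1 hm'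
  refine ⟨J, J', h3.antisymm ?_, h4.antisymm ?_, hmul⟩ <;> nlinarith

lemma Ideal.card_absNorm_eq_mul {m n : ℕ} (hm : m ≠ 0) (hn : n ≠ 0) (hmn : m.Coprime n) :
    Nat.card {I : Ideal R // I.absNorm = m * n} =
      Nat.card {I : Ideal R // I.absNorm = m} * Nat.card {I : Ideal R // I.absNorm = n} := by
  rw [← Nat.card_prod]
  refine (Nat.card_congr (Equiv.ofBijective (fun J : {I : Ideal R // I.absNorm = m} ×
    {I : Ideal R // I.absNorm = n} ↦ (⟨J.1.1 * J.2.1, by rw [map_mul, J.1.2, J.2.2]⟩ :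
      {I : Ideal R // I.absNorm = m * n})) ⟨?_, ?_⟩)).symm
  · rintro ⟨⟨J, hJ⟩, ⟨J', hJ'⟩⟩ ⟨⟨L, hL⟩, ⟨L', hL'⟩⟩ h
    have h : J * J' = L * L' := congrArg Subtype.val h
    have h1 : J = L := by
      rw [← Ideal.mul_sup_span_natCast_eq hmn hJ hJ', h, Ideal.mul_sup_span_natCast_eq hmn hL hL']
    have h2 : J' = L' := by
      rw [← Ideal.mul_sup_span_natCast_eq hmn.symm hJ' hJ, mul_comm, h, mul_comm,
        Ideal.mul_sup_span_natCast_eq hmn.symm hL' hL]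
    subst h1 h2
    rfl
  · rintro ⟨I, hI⟩
    obtain ⟨J, J', hJ, hJ', h⟩ := Ideal.exists_mul_eq_of_absNorm_eq_mul hm hn hmn hI
    exact ⟨⟨⟨J, hJ⟩, ⟨J', hJ'⟩⟩, Subtype.ext h⟩

lemma Ideal.card_absNorm_eq_pow_of_inert (h2 : Module.finrank ℤ R = 2) {q : ℕ} (hq : q.Prime)
    (hP : Prime (Ideal.span {(q : R)})) (k : ℕ) :
    Nat.card {I : Ideal R // I.absNorm = q ^ k} = if Even k then 1 else 0 := by
  have key : ∀ I : Ideal R, I.absNorm = q ^ k → ∃ j, k = 2 * j ∧ I = Ideal.span {(q : R)} ^ j := by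
    intro I hI
    obtain ⟨j, -, hj⟩ := (dvd_prime_pow hP k).mp (Ideal.dvd_span_pow_of_absNorm_eq hI)
    rw [associated_iff_eq] at hj
    refine ⟨j, ?_, hj⟩
    rw [hj, map_pow, Ideal.absNorm_span_natCast, h2, ← pow_mul] at hI
    exact (Nat.pow_right_injective hq.two_le hI).symm
  split_ifs with hk
  · obtain ⟨j, rfl⟩ := even_iff_exists_two_mul.mp hk
    rw [Nat.card_eq_one_iff_unique]
    refine ⟨⟨fun I J ↦ Subtype.ext ?_⟩, ⟨Ideal.span {(q : R)} ^ j, ?_⟩⟩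
    · obtain ⟨i, hi, hI⟩ := key I I.2
      obtain ⟨i', hi', hJ⟩ := key J J.2
      rw [hI, hJ]
      congr 1
      omega
    · rw [map_pow, Ideal.absNorm_span_natCast, h2, ← pow_mul]
  · have : IsEmpty {I : Ideal R // I.absNorm = q ^ k} := by
      refine ⟨fun I ↦ hk ?_⟩
      obtain ⟨j, hj, -⟩ := key I I.2
      exact hj ▸ even_two_mul j
    exact Nat.card_of_isEmpty

end IdealCount

section QuadraticOrder

variable {R : Type*} [CommRing R] {θ : R} {c : ℤ} {p q : ℕ}

lemma exists_intBasis_one_generator (h1 : ∀ x : R, ∃ m n : ℤ, x = m + n * θ)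
    (h2 : ∀ m n : ℤ, (m : R) + n * θ = 0 → m = 0 ∧ n = 0) :
    ∃ B : Module.Basis (Fin 2) ℤ R, ⇑B = ![1, θ] := by
  have hli : LinearIndependent ℤ ![1, θ] := by
    rw [LinearIndependent.pair_iff]
    intro s t h
    refine h2 s t ?_
    rw [← h]
    simp
  have hsp : ⊤ ≤ Submodule.span ℤ (Set.range ![1, θ]) := by
    rintro x -
    obtain ⟨a, b, rfl⟩ := h1 x
    rw [Matrix.range_cons, Matrix.range_cons, Matrix.range_empty, Set.union_empty,
      Set.singleton_union, Submodule.mem_span_pair]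
    exact ⟨a, b, by simp⟩
  exact ⟨Module.Basis.mk hli hsp, by simp⟩

lemma dvd_of_add_mul_mem_span_natCast (h1 : ∀ x : R, ∃ m n : ℤ, x = m + n * θ)
    (h2 : ∀ m n : ℤ, (m : R) + n * θ = 0 → m = 0 ∧ n = 0) {m n : ℤ}
    (h : (m : R) + n * θ ∈ Ideal.span {(q : R)}) : (q : ℤ) ∣ m ∧ (q : ℤ) ∣ n := by
  obtain ⟨x, hx⟩ := Ideal.mem_span_singleton.mp h
  obtain ⟨a, b, rfl⟩ := h1 x
  obtain ⟨h3, h4⟩ := h2 (m - q * a) (n - q * b) (by push_cast; linear_combination hx)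
  exact ⟨⟨a, by linarith⟩, ⟨b, by linarith⟩⟩

lemma Ideal.dvd_of_intCast_mem {I : Ideal R} (hI : I ≠ ⊤) (hq : q.Prime) (hqI : (q : R) ∈ I)
    {a : ℤ} (ha : (a : R) ∈ I) : (q : ℤ) ∣ a := by
  by_contra h
  obtain ⟨u, v, huv⟩ := (Nat.prime_iff_prime_int.mp hq).coprime_iff_not_dvd.mpr h
  refine hI ((Ideal.eq_top_iff_one I).mpr ?_)
  have : (1 : R) = u * q + v * a := by exact_mod_cast (congrArg (Int.cast : ℤ → R) huv).symm
  rw [this]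
  exact I.add_mem (I.mul_mem_left _ hqI) (I.mul_mem_left _ ha)

variable [IsDedekindDomain R] [Module.Free ℤ R]

lemma Ideal.prime_of_absNorm_eq_prime {P : Ideal R} (hq : q.Prime) (hP : P.absNorm = q) :
    Prime P := by
  have hP0 : P ≠ ⊥ := by
    rintro rfl
    rw [Ideal.absNorm_bot] at hP
    exact hq.ne_zero hP.symm
  exact Ideal.prime_of_isPrime hP0 (Ideal.isPrime_of_irreducible_absNorm (hP ▸ hq))

variable [Module.Finite ℤ R]

lemma card_absNorm_eq_pow_of_root (h1 : ∀ x : R, ∃ m n : ℤ, x = m + n * θ)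
    (h2 : ∀ m n : ℤ, (m : R) + n * θ = 0 → m = 0 ∧ n = 0) (hθ : θ ^ 2 - θ + c = 0)
    (hc : 4 * c = p + 1) (hp : p.Prime) (hq : q.Prime) (hqp : q ≠ p) {t : ℤ}
    (ht : (q : ℤ) ∣ t ^ 2 - t + c) (k : ℕ) :
    Nat.card {I : Ideal R // I.absNorm = q ^ k} = k + 1 := by
  obtain ⟨B, -⟩ := exists_intBasis_one_generator h1 h2
  have hrank : Module.finrank ℤ R = 2 := by rw [Module.finrank_eq_card_basis B, Fintype.card_fin]
  have ht' : ¬ (q : ℤ) ∣ 1 - 2 * t := by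
    intro h
    have h3 : (q : ℤ) ∣ p := by
      have : (p : ℤ) = 4 * (t ^ 2 - t + c) - (1 - 2 * t) * (1 - 2 * t) := by
        linear_combination -hc
      rw [this]
      exact dvd_sub (ht.mul_left _) (h.mul_left _)
    exact hqp ((Nat.prime_dvd_prime_iff_eq hq hp).mp (Int.natCast_dvd_natCast.mp h3))
  obtain ⟨u, v, huv⟩ := (Nat.prime_iff_prime_int.mp hq).coprime_iff_not_dvd.mpr ht'
  have huvR : (u : R) * q + v * (1 - 2 * t) = 1 := by
    exact_mod_cast congrArg (Int.cast : ℤ → R) huv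
  set P : Ideal R := Ideal.span {(q : R), θ - t} with hP
  set P' : Ideal R := Ideal.span {(q : R), θ - 1 + t} with hP'
  have hqP : (q : R) ∈ P := Ideal.subset_span (by simp)
  have hqP' : (q : R) ∈ P' := Ideal.subset_span (by simp)
  have htP : θ - t ∈ P := Ideal.subset_span (by simp)
  have htP' : θ - 1 + t ∈ P' := Ideal.subset_span (by simp)
  have hPP : P * P' = Ideal.span {(q : R)} := by
    apply le_antisymm
    · rw [hP, hP', Ideal.span_pair_mul_span_pair, Ideal.span_le]
      obtain ⟨d, hd⟩ := ht
      have hdR : (t : R) ^ 2 - t + c = q * d := by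
        exact_mod_cast congrArg (Int.cast : ℤ → R) hd
      rintro x (rfl | rfl | rfl | rfl)
      · exact Ideal.mem_span_singleton.mpr (dvd_mul_right _ _)
      · exact Ideal.mem_span_singleton.mpr (dvd_mul_right _ _)
      · exact Ideal.mem_span_singleton.mpr (dvd_mul_left _ _)
      · exact Ideal.mem_span_singleton.mpr ⟨-d, by linear_combination hθ - hdR⟩
    · rw [Ideal.span_singleton_le_iff_mem]
      have h3 : (q : R) = u * (q * q) + v * ((θ - t) * q - q * (θ - 1 + t)) := by
        linear_combination -(q : R) * huvR
      rw [h3]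
      exact add_mem (Ideal.mul_mem_left _ _ (Ideal.mul_mem_mul hqP hqP'))
        (Ideal.mul_mem_left _ _ (sub_mem (Ideal.mul_mem_mul htP hqP')
          (Ideal.mul_mem_mul hqP htP')))
  have hnt : P ≠ ⊤ := by
    intro h
    rw [h, Ideal.top_mul] at hPP
    rw [hPP] at htP'
    obtain ⟨-, h3⟩ := dvd_of_add_mul_mem_span_natCast (θ := θ) (m := t - 1) (n := 1) h1 h2
      (by convert htP' using 1; push_cast; ring)
    exact hq.one_lt.ne' (by exact_mod_cast Int.eq_one_of_dvd_one (by positivity) h3)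
  have hnt' : P' ≠ ⊤ := by
    intro h
    rw [h, Ideal.mul_top] at hPP
    rw [hPP] at htP
    obtain ⟨-, h3⟩ := dvd_of_add_mul_mem_span_natCast (θ := θ) (m := -t) (n := 1) h1 h2
      (by convert htP using 1; push_cast; ring)
    exact hq.one_lt.ne' (by exact_mod_cast Int.eq_one_of_dvd_one (by positivity) h3)
  have hN : P.absNorm * P'.absNorm = q ^ 2 := by
    rw [← map_mul, hPP, Ideal.absNorm_span_natCast, hrank]
  obtain ⟨hPN, hPN'⟩ := (hq.mul_eq_prime_sq_iff (mt Ideal.absNorm_eq_one_iff.mp hnt)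
    (mt Ideal.absNorm_eq_one_iff.mp hnt')).mp hN
  have hne : P ≠ P' := by
    intro h
    rw [← h] at htP'
    refine ht' (Ideal.dvd_of_intCast_mem hnt hq hqP ?_)
    have := sub_mem htP htP'
    convert this using 1
    push_cast
    ring
  exact Ideal.card_absNorm_eq_pow_of_split hq (Ideal.prime_of_absNorm_eq_prime hq hPN)
    (Ideal.prime_of_absNorm_eq_prime hq hPN') hne hPN hPN' hPP k

lemma card_absNorm_eq_pow_of_dvd_discr (h1 : ∀ x : R, ∃ m n : ℤ, x = m + n * θ)
    (h2 : ∀ m n : ℤ, (m : R) + n * θ = 0 → m = 0 ∧ n = 0) (hθ : θ ^ 2 - θ + c = 0)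
    (hc : 4 * c = p + 1) (hp : p.Prime) (k : ℕ) :
    Nat.card {I : Ideal R // I.absNorm = p ^ k} = 1 := by
  obtain ⟨B, -⟩ := exists_intBasis_one_generator h1 h2
  have hrank : Module.finrank ℤ R = 2 := by rw [Module.finrank_eq_card_basis B, Fintype.card_fin]
  have hcR : 4 * (c : R) = p + 1 := by exact_mod_cast congrArg (Int.cast : ℤ → R) hc
  have hsq : Ideal.span {2 * θ - 1} ^ 2 = Ideal.span {(p : R)} := by
    rw [Ideal.span_singleton_pow, ← Ideal.span_singleton_neg]
    congr 2
    linear_combination -4 * hθ + hcR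
  have hN : (Ideal.span {2 * θ - 1}).absNorm = p := by
    refine Nat.pow_left_injective two_ne_zero ?_
    simp only
    rw [← map_pow, hsq, Ideal.absNorm_span_natCast, hrank]
  exact Ideal.card_absNorm_eq_pow_of_ramified hp (Ideal.prime_of_absNorm_eq_prime hp hN) hN hsq k

lemma prime_span_natCast_of_no_root (h1 : ∀ x : R, ∃ m n : ℤ, x = m + n * θ)
    (h2 : ∀ m n : ℤ, (m : R) + n * θ = 0 → m = 0 ∧ n = 0) (hθ : θ ^ 2 - θ + c = 0)
    (hq : q.Prime) (ht : ∀ t : ℤ, ¬ (q : ℤ) ∣ t ^ 2 - t + c) :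
    Prime (Ideal.span {(q : R)}) := by
  obtain ⟨B, -⟩ := exists_intBasis_one_generator h1 h2
  have hrank : Module.finrank ℤ R = 2 := by rw [Module.finrank_eq_card_basis B, Fintype.card_fin]
  have hNq : (Ideal.span {(q : R)}).absNorm = q ^ 2 := by rw [Ideal.absNorm_span_natCast, hrank]
  have hnt : Ideal.span {(q : R)} ≠ ⊤ := by
    rw [← Ideal.absNorm_eq_one_iff.ne, hNq]
    exact (Nat.one_lt_pow two_ne_zero hq.one_lt).ne'
  obtain ⟨P, hPmax, hle⟩ := Ideal.exists_le_maximal _ hnt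
  have hqP : (q : R) ∈ P := hle (Ideal.mem_span_singleton_self _)
  obtain ⟨J, hJ⟩ := Ideal.dvd_iff_le.mpr hle
  have hN : P.absNorm * J.absNorm = q ^ 2 := by rw [← map_mul, ← hJ, hNq]
  have hP1 : P.absNorm ≠ 1 := mt Ideal.absNorm_eq_one_iff.mp hPmax.ne_top
  have hbot : P ≠ ⊥ := by
    rintro rfl
    rw [Ideal.absNorm_bot, zero_mul] at hN
    exact pow_ne_zero 2 hq.ne_zero hN.symm
  by_cases hJ1 : J.absNorm = 1
  · rw [Ideal.absNorm_eq_one_iff.mp hJ1, Ideal.mul_top] at hJ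
    rw [hJ]
    exact Ideal.prime_of_isPrime hbot hPmax.isPrime
  · exfalso
    obtain ⟨hPN, -⟩ := (hq.mul_eq_prime_sq_iff hP1 hJ1).mp hN
    have : Fact q.Prime := ⟨hq⟩
    have hcard : Nat.card (R ⧸ P) = q := by
      rw [← hPN, Ideal.absNorm_apply, Submodule.cardQuot_apply]
    have : Finite (R ⧸ P) := Nat.finite_of_card_ne_zero (hcard ▸ hq.ne_zero)
    have : Fintype (R ⧸ P) := Fintype.ofFinite _
    rw [Nat.card_eq_fintype_card] at hcard
    let e := ZMod.ringEquivOfPrime (R ⧸ P) hq hcard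
    obtain ⟨t, ht'⟩ := e.surjective (Ideal.Quotient.mk P θ)
    obtain ⟨t, rfl⟩ := ZMod.intCast_surjective t
    rw [map_intCast, ← map_intCast (Ideal.Quotient.mk P), Ideal.Quotient.eq] at ht'
    refine ht t (Ideal.dvd_of_intCast_mem hPmax.ne_top hq hqP ?_)
    convert P.mul_mem_left (t + θ - 1) ht' using 1
    push_cast
    linear_combination hθ

end QuadraticOrder

section QuadraticCharacter

variable {p : ℕ} [Fact p.Prime] {c : ℤ}

lemma exists_dvd_iff_quadraticChar_eq_one (hp : p % 4 = 3) (hc : 4 * c = p + 1) {q : ℕ}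
    (hq : q.Prime) (hqp : q ≠ p) :
    (∃ t : ℤ, (q : ℤ) ∣ t ^ 2 - t + c) ↔ quadraticChar (ZMod p) q = 1 := by
  have hpp : p.Prime := Fact.out
  have hcharp : ringChar (ZMod p) ≠ 2 := by rw [ZMod.ringChar_zmod_n]; omega
  have hfact : Fact q.Prime := ⟨hq⟩
  rcases eq_or_ne q 2 with rfl | hq2
  · have heven : ∀ t : ℤ, (2 : ℤ) ∣ t ^ 2 - t := fun t ↦ by
      have := Int.even_mul_pred_self t
      rw [even_iff_two_dvd] at this
      rwa [show t ^ 2 - t = t * (t - 1) by ring]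
    rw [show ((2 : ℕ) : ZMod p) = 2 from rfl, quadraticChar_two hcharp, ZMod.card, ZMod.χ₈_nat_eq_if_mod_eight]
    have h8 : p % 8 = 3 ∨ p % 8 = 7 := by omega
    have hiff : (∃ t : ℤ, ((2 : ℕ) : ℤ) ∣ t ^ 2 - t + c) ↔ (2 : ℤ) ∣ c :=
      ⟨fun ⟨t, ht⟩ ↦ (dvd_add_right (heven t)).mp ht, fun h ↦ ⟨0, by simpa using h⟩⟩
    rw [hiff]
    rcases h8 with h8 | h8
    · rw [if_neg (by omega), if_neg (by omega)]
      constructor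
      · intro h; omega
      · intro h; norm_num at h
    · rw [if_neg (by omega), if_pos (by omega)]
      simp only [iff_true]
      omega
  · have h2 : (2 : ZMod q) ≠ 0 := by
      intro h
      have : ((2 : ℕ) : ZMod q) = 0 := by exact_mod_cast h
      rw [ZMod.natCast_eq_zero_iff] at this
      exact hq2 ((Nat.prime_dvd_prime_iff_eq hq Nat.prime_two).mp this)
    have hp0 : (p : ZMod q) ≠ 0 := by
      rw [Ne, ZMod.natCast_eq_zero_iff]
      exact fun h ↦ hqp ((Nat.prime_dvd_prime_iff_eq hq hpp).mp h)
    have hcq : 4 * (c : ZMod q) = p + 1 := by exact_mod_cast congrArg (Int.cast : ℤ → ZMod q) hc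
    rw [quadraticChar_odd_prime hcharp hq2 (by rw [ZMod.ringChar_zmod_n]; exact hqp.symm),
      ZMod.card, ZMod.χ₄_nat_three_mod_four hp]
    have h4 : (((-1 : ℤ) : ZMod q) * (p : ZMod q)) ≠ 0 := by simpa using hp0
    rw [quadraticChar_one_iff_isSquare h4]
    constructor
    · rintro ⟨t, ht⟩
      refine ⟨2 * t - 1, ?_⟩
      rw [← ZMod.intCast_zmod_eq_zero_iff_dvd] at ht
      push_cast at ht ⊢
      linear_combination hcq - 4 * ht
    · rintro ⟨s, hs⟩
      obtain ⟨t, ht⟩ := ZMod.intCast_surjective ((s + 1) / 2)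
      refine ⟨t, ?_⟩
      rw [← ZMod.intCast_zmod_eq_zero_iff_dvd]
      push_cast at hs ⊢
      rw [ht]
      have hs' : 2 * ((s + 1) / 2) = s + 1 := mul_div_cancel₀ _ h2
      have h44 : (4 : ZMod q) ≠ 0 := by
        rw [show (4 : ZMod q) = 2 * 2 by norm_num]
        exact mul_ne_zero h2 h2
      apply (mul_eq_zero_iff_left h44).mp
      linear_combination (2 * ((s + 1) / 2) - 1 + s) * hs' + hcq - hs

variable {R : Type*} [CommRing R] {θ : R} [IsDedekindDomain R] [Module.Free ℤ R]
  [Module.Finite ℤ R]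

lemma card_absNorm_eq_pow (h1 : ∀ x : R, ∃ m n : ℤ, x = m + n * θ)
    (h2 : ∀ m n : ℤ, (m : R) + n * θ = 0 → m = 0 ∧ n = 0) (hθ : θ ^ 2 - θ + c = 0)
    (hp : p % 4 = 3) (hc : 4 * c = p + 1) {q : ℕ} (hq : q.Prime) (k : ℕ) :
    (Nat.card {I : Ideal R // I.absNorm = q ^ k} : ℤ) =
      ∑ i ∈ Finset.range (k + 1), quadraticChar (ZMod p) q ^ i := by
  have hpp : p.Prime := Fact.out
  rcases eq_or_ne q p with rfl | hqp
  · rw [card_absNorm_eq_pow_of_dvd_discr h1 h2 hθ hc hpp, ZMod.natCast_self,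
      quadraticChar_zero, Finset.sum_range_succ']
    simp
  · have hq0 : (q : ZMod p) ≠ 0 := by
      rw [Ne, ZMod.natCast_eq_zero_iff]
      exact fun h ↦ hqp.symm ((Nat.prime_dvd_prime_iff_eq hpp hq).mp h)
    rcases quadraticChar_dichotomy hq0 with h | h
    · obtain ⟨t, ht⟩ := (exists_dvd_iff_quadraticChar_eq_one hp hc hq hqp).mpr h
      rw [card_absNorm_eq_pow_of_root h1 h2 hθ hc hpp hq hqp ht, h]
      simp
    · have ht : ∀ t : ℤ, ¬ (q : ℤ) ∣ t ^ 2 - t + c := by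
        intro t ht
        have := (exists_dvd_iff_quadraticChar_eq_one hp hc hq hqp).mp ⟨t, ht⟩
        rw [h] at this
        norm_num at this
      obtain ⟨B, -⟩ := exists_intBasis_one_generator h1 h2
      have hrank : Module.finrank ℤ R = 2 := by
        rw [Module.finrank_eq_card_basis B, Fintype.card_fin]
      rw [Ideal.card_absNorm_eq_pow_of_inert hrank hq
        (prime_span_natCast_of_no_root h1 h2 hθ hq ht), h, neg_one_geom_sum]
      by_cases hk : Even k
      · rw [if_pos hk, if_neg (by simpa [Nat.even_add_one] using hk)]
        rfl
      · rw [if_neg hk, if_pos (by simpa [Nat.even_add_one] using hk)]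
        rfl

lemma card_absNorm_eq_sum_divisors (h1 : ∀ x : R, ∃ m n : ℤ, x = m + n * θ)
    (h2 : ∀ m n : ℤ, (m : R) + n * θ = 0 → m = 0 ∧ n = 0) (hθ : θ ^ 2 - θ + c = 0)
    (hp : p % 4 = 3) (hc : 4 * c = p + 1) {n : ℕ} (hn : n ≠ 0) :
    (Nat.card {I : Ideal R // I.absNorm = n} : ℤ) =
      ∑ d ∈ n.divisors, quadraticChar (ZMod p) d := by
  let A : ArithmeticFunction ℤ :=
    ⟨fun n ↦ if n = 0 then 0 else (Nat.card {I : Ideal R // I.absNorm = n} : ℤ), by simp⟩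
  let F : ArithmeticFunction ℤ := ⟨fun n ↦ quadraticChar (ZMod p) n, by simp⟩
  have hA : A.IsMultiplicative := by
    rw [ArithmeticFunction.IsMultiplicative.iff_ne_zero]
    refine ⟨?_, fun {m n} hm hn hmn ↦ ?_⟩
    · simp only [A, ArithmeticFunction.coe_mk]
      simp
    · simp only [A, ArithmeticFunction.coe_mk, hm, hn, mul_eq_zero, or_self, if_false]
      rw [Ideal.card_absNorm_eq_mul hm hn hmn]
      push_cast
      rfl
  have hF : F.IsMultiplicative := by
    rw [ArithmeticFunction.IsMultiplicative.iff_ne_zero]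
    refine ⟨?_, fun {m n} _ _ _ ↦ ?_⟩
    · simp [F]
    · simp only [F, ArithmeticFunction.coe_mk, Nat.cast_mul, map_mul]
  have hζF := ArithmeticFunction.isMultiplicative_zeta.natCast.mul hF (R := ℤ)
  have heq : A = (ArithmeticFunction.zeta : ArithmeticFunction ℤ) * F := by
    rw [hA.eq_iff_eq_on_prime_powers _ _ hζF]
    intro q k hq
    rw [ArithmeticFunction.coe_zeta_mul_apply, Nat.sum_divisors_prime_pow hq]
    simp only [A, F, ArithmeticFunction.coe_mk, pow_ne_zero k hq.ne_zero, if_false]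
    rw [card_absNorm_eq_pow h1 h2 hθ hp hc hq]
    simp only [Nat.cast_pow, map_pow]
  have hA' : A n = Nat.card {I : Ideal R // I.absNorm = n} := if_neg hn
  rw [← hA', heq, ArithmeticFunction.coe_zeta_mul_apply]
  rfl

end QuadraticCharacter

lemma exists_sq_eq_neg_of_isSplittingField (p : ℕ) (K : Type*) [Field K] [NumberField K]
    [IsSplittingField ℚ K (X ^ 2 + C (p : ℚ))] :
    ∃ α : K, α ^ 2 = -p ∧ ∀ x : K, ∃ a b : ℚ, x = a + b * α := by
  set f : ℚ[X] := X ^ 2 + C (p : ℚ) with hf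
  have hdeg : f.natDegree = 2 := by rw [hf]; compute_degree!
  have hf0 : f ≠ 0 := fun h ↦ by simp [h] at hdeg
  have hsplit := IsSplittingField.splits K f
  obtain ⟨α, hα⟩ := hsplit.exists_eval_eq_zero (by
    rw [degree_map, degree_eq_natDegree hf0, hdeg]; norm_num)
  have hα2 : α ^ 2 = -p := by
    simp [hf] at hα
    linear_combination hα
  refine ⟨α, hα2, fun x ↦ ?_⟩
  have hx : x ∈ Algebra.adjoin ℚ (f.rootSet K) := by
    rw [IsSplittingField.adjoin_rootSet K f]; trivial
  induction hx using Algebra.adjoin_induction with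
  | mem y hy =>
    rw [mem_rootSet] at hy
    have h1 : y ^ 2 = -p := by
      have := hy.2
      simp [hf] at this
      linear_combination this
    have h2 : (y - α) * (y + α) = 0 := by linear_combination h1 - hα2
    rcases mul_eq_zero.mp h2 with h | h
    · exact ⟨0, 1, by push_cast; linear_combination h⟩
    · exact ⟨0, -1, by push_cast; linear_combination h⟩
  | algebraMap r => exact ⟨r, 0, by simp⟩
  | add y z _ _ hy hz =>
    obtain ⟨a, b, rfl⟩ := hy
    obtain ⟨c, d, rfl⟩ := hz
    exact ⟨a + c, b + d, by push_cast; ring⟩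
  | mul y z _ _ hy hz =>
    obtain ⟨a, b, rfl⟩ := hy
    obtain ⟨c, d, rfl⟩ := hz
    exact ⟨a * c - p * b * d, a * d + b * c, by push_cast; linear_combination (b * d : K) * hα2⟩

section ImaginaryQuadratic

variable {p : ℕ} {K : Type*} [Field K] [NumberField K] {α : K}

lemma add_mul_eq_zero_of_sq_eq_neg (hp : 0 < p) (hα : α ^ 2 = -p) {a b : ℚ}
    (h : (a : K) + b * α = 0) : a = 0 ∧ b = 0 := by
  have h1 : ((a ^ 2 + p * b ^ 2 : ℚ) : K) = 0 := by
    push_cast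
    linear_combination (a - b * α : K) * h + (b : K) ^ 2 * hα
  have h2 : a ^ 2 + p * b ^ 2 = 0 := by exact_mod_cast h1
  have h3 : (0 : ℚ) < p := by exact_mod_cast hp
  have h4 : b ^ 2 = 0 := by
    by_contra hb
    have : 0 < b ^ 2 := lt_of_le_of_ne (sq_nonneg b) (Ne.symm hb)
    nlinarith [sq_nonneg a, mul_pos h3 this]
  have hb : b = 0 := by simpa using h4
  subst hb
  simpa using h2

lemma exists_basis_one_sqrt (hp : 0 < p) (hα : α ^ 2 = -p)
    (hspan : ∀ x : K, ∃ a b : ℚ, x = a + b * α) :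
    ∃ B : Module.Basis (Fin 2) ℚ K, B 0 = 1 ∧ B 1 = α := by
  have hli : LinearIndependent ℚ ![1, α] := by
    rw [LinearIndependent.pair_iff]
    intro s t h
    refine add_mul_eq_zero_of_sq_eq_neg hp hα ?_
    rw [← h, Algebra.smul_def, Algebra.smul_def]
    simp
  have hsp : ⊤ ≤ Submodule.span ℚ (Set.range ![1, α]) := by
    rintro x -
    obtain ⟨a, b, rfl⟩ := hspan x
    rw [Matrix.range_cons, Matrix.range_cons, Matrix.range_empty, Set.union_empty,
      Set.singleton_union, Submodule.mem_span_pair]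
    exact ⟨a, b, by rw [Algebra.smul_def, Algebra.smul_def]; simp⟩
  exact ⟨Module.Basis.mk hli hsp, by simp, by simp⟩

lemma trace_norm_add_mul_sqrt (hp : 0 < p) (hα : α ^ 2 = -p)
    (hspan : ∀ x : K, ∃ a b : ℚ, x = a + b * α) (a b : ℚ) :
    Algebra.trace ℚ K (a + b * α) = 2 * a ∧ Algebra.norm ℚ ((a : K) + b * α) = a ^ 2 + p * b ^ 2 := by
  obtain ⟨B, h0, h1⟩ := exists_basis_one_sqrt hp hα hspan
  have hrepr : ∀ c d : ℚ, B.repr ((c : K) + d * α) = Finsupp.single 0 c + Finsupp.single 1 d := by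
    intro c d
    have : (c : K) + d * α = c • B 0 + d • B 1 := by
      rw [h0, h1, Algebra.smul_def, Algebra.smul_def]; simp
    rw [this, map_add, map_smul, map_smul, B.repr_self, B.repr_self]
    simp
  have hM : Algebra.leftMulMatrix B ((a : K) + b * α) = !![a, -p * b; b, a] := by
    have e1 : ((a : K) + b * α) * α = ((-p * b : ℚ) : K) + a * α := by
      push_cast; linear_combination (b : K) * hα
    ext i j
    rw [Algebra.leftMulMatrix_eq_repr_mul]
    fin_cases j
    · simp only [Fin.zero_eta, h0, mul_one, hrepr]
      fin_cases i <;> simp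
    · simp only [Fin.mk_one, h1, e1, hrepr]
      fin_cases i <;> simp
  constructor
  · rw [Algebra.trace_eq_matrix_trace B, hM, Matrix.trace_fin_two_of]; ring
  · rw [Algebra.norm_eq_matrix_det B, hM, Matrix.det_fin_two_of]; ring

lemma exists_int_eq_of_isIntegral {a : ℚ} (h : IsIntegral ℤ a) : ∃ m : ℤ, a = m := by
  obtain ⟨m, hm⟩ := IsIntegrallyClosed.isIntegral_iff.mp h
  exact ⟨m, hm.symm⟩

lemma exists_int_of_prime_mul_sq {p : ℕ} (hp : p.Prime) {b : ℚ} {m : ℤ} (h : p * b ^ 2 = m) :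
    ∃ n : ℤ, b = n := by
  have hp0 : (p : ℚ) ≠ 0 := by exact_mod_cast hp.ne_zero
  obtain ⟨M, hM⟩ : ∃ M : ℤ, p * b = M := by
    refine exists_int_eq_of_isIntegral (IsIntegral.of_pow two_pos ?_)
    have : (p * b) ^ 2 = ((p * m : ℤ) : ℚ) := by push_cast; rw [← h]; ring
    rw [this]
    exact isIntegral_algebraMap (R := ℤ) (A := ℚ) (x := (p * m : ℤ))
  have h2 : M ^ 2 = p * m := by
    have : ((M ^ 2 : ℤ) : ℚ) = ((p * m : ℤ) : ℚ) := by push_cast; rw [← h, ← hM]; ring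
    exact_mod_cast this
  obtain ⟨n, hn⟩ := (Nat.prime_iff_prime_int.mp hp).dvd_of_dvd_pow (Dvd.intro _ h2.symm)
  refine ⟨n, mul_left_cancel₀ hp0 ?_⟩
  rw [hM, hn]
  push_cast
  rfl

lemma exists_int_of_isIntegral_add_mul_sqrt (hp : p.Prime) (hp4 : p % 4 = 3) (hα : α ^ 2 = -p)
    (hspan : ∀ x : K, ∃ a b : ℚ, x = a + b * α) {x : K} (hx : IsIntegral ℤ x) :
    ∃ m n : ℤ, x = m + n * ((1 + α) / 2) := by
  obtain ⟨a, b, rfl⟩ := hspan x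
  obtain ⟨htr, hnm⟩ := trace_norm_add_mul_sqrt hp.pos hα hspan a b
  obtain ⟨A, hA⟩ := exists_int_eq_of_isIntegral
    (htr ▸ Algebra.isIntegral_trace (R := ℤ) (L := ℚ) hx)
  obtain ⟨N, hN⟩ := exists_int_eq_of_isIntegral
    (hnm ▸ Algebra.isIntegral_norm (R := ℤ) (K := ℚ) hx)
  obtain ⟨B, hB⟩ := exists_int_of_prime_mul_sq hp (b := 2 * b) (m := 4 * N - A ^ 2) (by
    push_cast; rw [← hA, ← hN]; ring)
  have hrel : A ^ 2 + p * B ^ 2 = 4 * N := by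
    have : ((A ^ 2 + p * B ^ 2 : ℤ) : ℚ) = ((4 * N : ℤ) : ℚ) := by
      push_cast; rw [← hA, ← hB, ← hN]; ring
    exact_mod_cast this
  have hpar : (A - B) % 2 = 0 := by
    obtain ⟨k, hk⟩ : ∃ k : ℤ, (p : ℤ) = 4 * k + 3 := ⟨p / 4, by omega⟩
    have h3 : (A - B) * (A + B) = 4 * (N - (k + 1) * B ^ 2) := by
      rw [hk] at hrel; linear_combination hrel
    rcases Int.even_or_odd (A - B) with h | h
    · exact Int.even_iff.mp h
    · have h5 : Odd (A + B) := by
        have := h.add_even (even_two_mul B)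
        convert this using 1; ring
      have h4 := h.mul h5
      rw [h3, Int.odd_iff] at h4
      omega
  obtain ⟨m, hm⟩ := Int.dvd_of_emod_eq_zero hpar
  refine ⟨m, B, ?_⟩
  have ha : a = m + B / 2 := by
    have : (A : ℚ) - B = 2 * m := by exact_mod_cast hm
    linarith
  have hb : b = B / 2 := by linarith
  rw [ha, hb]
  push_cast
  ring

open NumberField in
lemma exists_integralBasis_generator (hp : p.Prime) (hp4 : p % 4 = 3) (hα : α ^ 2 = -p)
    (hspan : ∀ x : K, ∃ a b : ℚ, x = a + b * α) :
    ∃ θ : 𝓞 K, 2 * algebraMap (𝓞 K) K θ = 1 + α ∧ (∀ c : ℤ, 4 * c = p + 1 → θ ^ 2 - θ + c = 0) ∧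
      (∀ x : 𝓞 K, ∃ m n : ℤ, x = m + n * θ) ∧
      ∀ m n : ℤ, (m : 𝓞 K) + n * θ = 0 → m = 0 ∧ n = 0 := by
  have hc : 4 * (((p + 1) / 4 : ℕ) : ℤ) = p + 1 := by omega
  have hcK : 4 * (((p + 1) / 4 : ℕ) : K) = p + 1 := by exact_mod_cast hc
  have h_int : IsIntegral ℤ ((1 + α) / 2) := by
    refine ⟨X ^ 2 - X + C (((p + 1) / 4 : ℕ) : ℤ), by monicity!, ?_⟩
    simp only [eval₂_add, eval₂_sub, eval₂_X_pow, eval₂_X, eval₂_C]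
    simp only [algebraMap_int_eq, eq_intCast, Int.cast_natCast]
    linear_combination (1 / 4 : K) * hcK + (1 / 4 : K) * hα
  obtain ⟨θ, hθK⟩ : ∃ θ : 𝓞 K, algebraMap (𝓞 K) K θ = (1 + α) / 2 := ⟨⟨(1 + α) / 2, h_int⟩, rfl⟩
  have h2 : 2 * algebraMap (𝓞 K) K θ = 1 + α := by rw [hθK]; ring
  refine ⟨θ, h2, fun c hc ↦ ?_, fun x ↦ ?_, fun m n h ↦ ?_⟩
  · apply FaithfulSMul.algebraMap_injective (𝓞 K) K
    have hcK : 4 * (c : K) = p + 1 := by exact_mod_cast hc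
    simp only [map_add, map_sub, map_pow, map_intCast, map_zero, hθK]
    linear_combination (1 / 4 : K) * hcK + (1 / 4 : K) * hα
  · obtain ⟨m, n, h⟩ := exists_int_of_isIntegral_add_mul_sqrt hp hp4 hα hspan x.isIntegral_coe
    refine ⟨m, n, FaithfulSMul.algebraMap_injective (𝓞 K) K ?_⟩
    simp only [map_add, map_mul, map_intCast, hθK, h]
  · have h1 : ((m + n / 2 : ℚ) : K) + (n / 2 : ℚ) * α = 0 := by
      have := congrArg (algebraMap (𝓞 K) K) h
      simp only [map_add, map_mul, map_intCast, map_zero, hθK] at this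
      push_cast
      linear_combination this
    obtain ⟨h3, h4⟩ := add_mul_eq_zero_of_sq_eq_neg hp.pos hα h1
    have hn : (n : ℚ) = 0 := by linarith
    have hm : (m : ℚ) = 0 := by rw [hn] at h3; linarith
    exact ⟨by exact_mod_cast hm, by exact_mod_cast hn⟩

open NumberField InfinitePlace in
lemma nrRealPlaces_eq_zero_of_sq_eq_neg (hp : 0 < p) (hα : α ^ 2 = -p) : nrRealPlaces K = 0 := by
  rw [nrRealPlaces_eq_zero_iff]
  refine ⟨fun w ↦ ?_⟩
  rw [← not_isReal_iff_isComplex]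
  rintro ⟨φ, hφ, -⟩
  have h1 : (hφ.embedding α) ^ 2 = -p := by rw [← map_pow, hα]; simp
  have h2 : (0 : ℝ) < p := by exact_mod_cast hp
  nlinarith [sq_nonneg (hφ.embedding α)]

open NumberField in
lemma isUnit_eq_one_or_neg_one (hp : p.Prime) (hp4 : p % 4 = 3) (hp7 : 5 ≤ p) (hα : α ^ 2 = -p)
    (hspan : ∀ x : K, ∃ a b : ℚ, x = a + b * α) (u : (𝓞 K)ˣ) : u = 1 ∨ u = -1 := by
  obtain ⟨m, n, h⟩ := exists_int_of_isIntegral_add_mul_sqrt hp hp4 hα hspan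
    (u : 𝓞 K).isIntegral_coe
  have h1 : algebraMap (𝓞 K) K u = ((m + n / 2 : ℚ) : K) + (n / 2 : ℚ) * α := by
    rw [h]; push_cast; ring
  have hN : |Algebra.norm ℚ (algebraMap (𝓞 K) K u)| = 1 :=
    NumberField.isUnit_iff_norm.mp u.isUnit
  rw [h1, (trace_norm_add_mul_sqrt hp.pos hα hspan _ _).2] at hN
  have hp0 : (0 : ℚ) ≤ p := Nat.cast_nonneg _
  rw [abs_of_nonneg (by positivity)] at hN
  have h2 : (2 * m + n) ^ 2 + p * n ^ 2 = 4 := by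
    have : (((2 * m + n) ^ 2 + p * n ^ 2 : ℤ) : ℚ) = (4 : ℤ) := by
      push_cast; linarith
    exact_mod_cast this
  have hn : n = 0 := by
    by_contra hn
    have h3 : 1 ≤ n ^ 2 := by
      have := sq_pos_of_ne_zero hn
      linarith
    have h4 : (5 : ℤ) ≤ p := by exact_mod_cast hp7
    nlinarith [sq_nonneg (2 * m + n)]
  subst hn
  have h5 : (m - 1) * (m + 1) = 0 := by linarith
  rcases mul_eq_zero.mp h5 with h6 | h6
  · left
    rw [sub_eq_zero.mp h6] at h
    exact Units.ext (FaithfulSMul.algebraMap_injective (𝓞 K) K (by simpa using h))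
  · right
    rw [eq_neg_of_add_eq_zero_left h6] at h
    exact Units.ext (FaithfulSMul.algebraMap_injective (𝓞 K) K (by simpa using h))

open NumberField in
lemma torsionOrder_eq_two (hp : p.Prime) (hp4 : p % 4 = 3) (hp7 : 5 ≤ p) (hα : α ^ 2 = -p)
    (hspan : ∀ x : K, ∃ a b : ℚ, x = a + b * α) : Units.torsionOrder K = 2 := by
  have hne : (1 : (𝓞 K)ˣ) ≠ -1 := by
    intro h
    have := congrArg (fun u : (𝓞 K)ˣ ↦ ((u : 𝓞 K) : K)) h
    simp at this
    norm_num [eq_neg_iff_add_eq_zero] at this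
  have : (Units.torsion K : Set (𝓞 K)ˣ) = {1, -1} := by
    ext u
    simp only [SetLike.mem_coe, Set.mem_insert_iff, Set.mem_singleton_iff]
    refine ⟨fun _ ↦ isUnit_eq_one_or_neg_one hp hp4 hp7 hα hspan u, ?_⟩
    rintro (rfl | rfl)
    · exact one_mem _
    · rw [Units.mem_torsion]
      intro w
      have h := InfinitePlace.norm_embedding_eq w (-1 : K)
      simp only [map_neg, map_one, norm_neg, norm_one] at h
      simp [← h]
  rw [Units.torsionOrder, ← SetLike.coe_sort_coe, this, Nat.card_coe_set_eq, Set.ncard_pair hne]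

open NumberField InfinitePlace in
lemma nrComplexPlaces_eq_one_of_sq_eq_neg (hp : 0 < p) (hα : α ^ 2 = -p)
    (hspan : ∀ x : K, ∃ a b : ℚ, x = a + b * α) : nrComplexPlaces K = 1 := by
  obtain ⟨B, -⟩ := exists_basis_one_sqrt hp hα hspan
  have h := card_add_two_mul_card_eq_rank K
  rw [nrRealPlaces_eq_zero_of_sq_eq_neg hp hα, Module.finrank_eq_card_basis B, Fintype.card_fin]
    at h
  omega

open NumberField InfinitePlace in
lemma regulator_eq_one (hp : 0 < p) (hα : α ^ 2 = -p)
    (hspan : ∀ x : K, ∃ a b : ℚ, x = a + b * α) : Units.regulator K = 1 := by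
  have h : Fintype.card (InfinitePlace K) = 1 := by
    rw [card_eq_nrRealPlaces_add_nrComplexPlaces, nrRealPlaces_eq_zero_of_sq_eq_neg hp hα,
      nrComplexPlaces_eq_one_of_sq_eq_neg hp hα hspan]
  have : IsEmpty {w : InfinitePlace K // w ≠ Units.dirichletUnitTheorem.w₀} :=
    ⟨fun w ↦ w.2 (Fintype.card_le_one_iff.mp h.le _ _)⟩
  classical
  rw [Units.regulator_eq_det', Matrix.det_isEmpty, abs_one]

open NumberField in
lemma discr_eq_neg (hp : p.Prime) (hp4 : p % 4 = 3) (hα : α ^ 2 = -p)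
    (hspan : ∀ x : K, ∃ a b : ℚ, x = a + b * α) : discr K = -p := by
  obtain ⟨θ, hθ, hθ2, h1, h2⟩ := exists_integralBasis_generator hp hp4 hα hspan
  obtain ⟨B, hB⟩ := exists_intBasis_one_generator h1 h2
  have htr : ∀ m n : ℤ, Algebra.trace ℤ (𝓞 K) (m + n * θ) = 2 * m + n := by
    intro m n
    have h3 := Algebra.coe_trace_int (K := K) (m + n * θ)
    have h4 : algebraMap (𝓞 K) K (m + n * θ) = ((m + n / 2 : ℚ) : K) + (n / 2 : ℚ) * α := by
      simp only [map_add, map_mul, map_intCast]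
      push_cast
      linear_combination (n / 2 : K) * hθ
    change _ = Algebra.trace ℚ K (algebraMap (𝓞 K) K _) at h3
    rw [h4, (trace_norm_add_mul_sqrt hp.pos hα hspan _ _).1] at h3
    have : ((Algebra.trace ℤ (𝓞 K) (m + n * θ) : ℤ) : ℚ) = ((2 * m + n : ℤ) : ℚ) := by
      rw [h3]; push_cast; ring
    exact_mod_cast this
  have hc : 4 * (((p + 1) / 4 : ℕ) : ℤ) = p + 1 := by omega
  have e1 := htr 1 0
  have e2 := htr 0 1
  have e3 := htr (-((p + 1) / 4 : ℕ)) 1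
  have hsq : θ * θ = ((-((p + 1) / 4 : ℕ) : ℤ) : 𝓞 K) + (1 : ℤ) * θ := by
    have := hθ2 _ hc
    push_cast at this ⊢
    linear_combination this
  simp only [Int.cast_one, Int.cast_zero, zero_mul, add_zero, zero_add, one_mul] at e1 e2
  rw [← hsq] at e3
  rw [← discr_eq_discr K B, Algebra.discr_def, Matrix.det_fin_two]
  simp only [Algebra.traceMatrix_apply, Algebra.traceForm_apply, hB, Matrix.cons_val_zero,
    Matrix.cons_val_one, one_mul, mul_one, e1, e2, e3]
  linarith

open NumberField in
lemma dedekindZeta_residue_eq (hp : p.Prime) (hp4 : p % 4 = 3) (hp7 : 5 ≤ p) (hα : α ^ 2 = -p)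
    (hspan : ∀ x : K, ∃ a b : ℚ, x = a + b * α) :
    dedekindZeta_residue K = Real.pi * classNumber K / Real.sqrt p := by
  rw [dedekindZeta_residue_def, nrRealPlaces_eq_zero_of_sq_eq_neg hp.pos hα,
    nrComplexPlaces_eq_one_of_sq_eq_neg hp.pos hα hspan, regulator_eq_one hp.pos hα hspan,
    torsionOrder_eq_two hp hp4 hp7 hα hspan, discr_eq_neg hp hp4 hα hspan]
  have : |((-(p : ℤ) : ℤ) : ℝ)| = p := by simp
  rw [this]
  have : Real.sqrt p ≠ 0 := by
    rw [Real.sqrt_ne_zero']; exact_mod_cast hp.pos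
  push_cast
  field_simp

end ImaginaryQuadratic

section ClassNumberFormula

open Filter Topology NumberField

variable {p : ℕ} [Fact p.Prime] {K : Type*} [Field K] [NumberField K] {α : K}

lemma dedekindZeta_eq_riemannZeta_mul_LFunction (hp : p % 4 = 3) (hα : α ^ 2 = -p)
    (hspan : ∀ x : K, ∃ a b : ℚ, x = a + b * α) {s : ℂ} (hs : 1 < s.re) :
    dedekindZeta K s = riemannZeta s *
      ZMod.LFunction (fun x : ZMod p ↦ (quadraticChar (ZMod p) x : ℂ)) s := by
  obtain ⟨θ, -, hθ, h1, h2⟩ := exists_integralBasis_generator Fact.out hp hα hspan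
  have hc : 4 * (((p + 1) / 4 : ℕ) : ℤ) = p + 1 := by omega
  rw [ZMod.LFunction_eq_LSeries _ hs, ← LSeries_one_eq_riemannZeta hs,
    ← LSeries_convolution' (LSeriesSummable_one_iff.mpr hs) (ZMod.LSeriesSummable_of_one_lt_re
      (fun x : ZMod p ↦ (quadraticChar (ZMod p) x : ℂ)) hs),
    dedekindZeta]
  refine LSeries_congr (fun {n} hn ↦ ?_) s
  have h := congrArg (Int.cast : ℤ → ℂ)
    (card_absNorm_eq_sum_divisors h1 h2 (hθ _ hc) hp hc hn)
  push_cast at h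
  rw [h, LSeries.convolution_def]
  simp only [Pi.one_apply, one_mul]
  rw [Nat.sum_divisorsAntidiagonal' (f := fun _ d ↦ (quadraticChar (ZMod p) d : ℂ))]

lemma classNumber_eq_sum (hp : p % 4 = 3) (hp7 : 5 ≤ p) (hα : α ^ 2 = -p)
    (hspan : ∀ x : K, ∃ a b : ℚ, x = a + b * α) :
    ∑ x : ZMod p, (x.val : ℂ) * (quadraticChar (ZMod p) x : ℂ) = -p * classNumber K := by
  have hpp : p.Prime := Fact.out
  set L := ZMod.LFunction (fun x : ZMod p ↦ (quadraticChar (ZMod p) x : ℂ)) with hL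
  have hsum : ∑ x : ZMod p, (quadraticChar (ZMod p) x : ℂ) = 0 := by
    exact_mod_cast quadraticChar_sum_zero (F := ZMod p) (by rw [ZMod.ringChar_zmod_n]; omega)
  have hcont : Continuous L := (ZMod.differentiable_LFunction_of_sum_zero hsum).continuous
  have hmap : Tendsto (fun s : ℝ ↦ (s : ℂ)) (𝓝[>] 1) (𝓝[≠] 1) := by
    refine tendsto_nhdsWithin_iff.mpr ⟨?_, ?_⟩
    · exact (Complex.continuous_ofReal.tendsto' 1 1 (by simp)).mono_left nhdsWithin_le_nhds
    · filter_upwards [self_mem_nhdsWithin] with s hs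
      simpa using (ne_of_gt (Set.mem_Ioi.mp hs))
  have h1 : Tendsto (fun s : ℝ ↦ ((s : ℂ) - 1) * riemannZeta s * L s) (𝓝[>] 1) (𝓝 (1 * L 1)) :=
    (riemannZeta_residue_one.comp hmap).mul
      ((hcont.tendsto 1).comp (hmap.mono_right nhdsWithin_le_nhds))
  have h2 : Tendsto (fun s : ℝ ↦ ((s : ℂ) - 1) * riemannZeta s * L s) (𝓝[>] 1)
      (𝓝 (dedekindZeta_residue K : ℂ)) := by
    refine (tendsto_sub_one_mul_dedekindZeta_nhdsGT K).congr' ?_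
    filter_upwards [self_mem_nhdsWithin] with s hs
    rw [dedekindZeta_eq_riemannZeta_mul_LFunction hp hα hspan (by simpa using hs), mul_assoc]
  have h3 := tendsto_nhds_unique h1 h2
  rw [one_mul, hL, LFunction_quadraticChar_one hp (gaussSum_quadraticChar_eq p hp),
    dedekindZeta_residue_eq hpp hp hp7 hα hspan] at h3
  have hp0 : (p : ℂ) ≠ 0 := by exact_mod_cast hpp.ne_zero
  have hsp : (Real.sqrt p : ℂ) ≠ 0 := by
    rw [Complex.ofReal_ne_zero, Real.sqrt_ne_zero']
    exact_mod_cast hpp.pos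
  have hpi : (Real.pi : ℂ) ≠ 0 := by exact_mod_cast Real.pi_ne_zero
  push_cast at h3
  field_simp at h3
  linear_combination -h3

lemma sum_val_mul_quadraticChar_eq_zero (hp : p % 4 = 1) :
    ∑ x : ZMod p, (x.val : ℂ) * (quadraticChar (ZMod p) x : ℂ) = 0 := by
  have hchar : ringChar (ZMod p) ≠ 2 := by rw [ZMod.ringChar_zmod_n]; omega
  have hneg : ∀ x : ZMod p, quadraticChar (ZMod p) (-x) = quadraticChar (ZMod p) x := by
    intro x
    rw [neg_eq_neg_one_mul, map_mul, quadraticChar_neg_one hchar, ZMod.card,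
      ZMod.χ₄_nat_one_mod_four hp, one_mul]
  have hsum : ∑ x : ZMod p, (quadraticChar (ZMod p) x : ℂ) = 0 := by
    exact_mod_cast quadraticChar_sum_zero hchar
  have h1 : ∀ x : ZMod p, (x.val : ℂ) * (quadraticChar (ZMod p) x : ℂ) +
      ((-x).val : ℂ) * (quadraticChar (ZMod p) (-x) : ℂ) = p * (quadraticChar (ZMod p) x : ℂ) := by
    intro x
    rcases eq_or_ne x 0 with rfl | hx
    · simp
    · have : NeZero x := ⟨hx⟩
      rw [hneg, ZMod.val_neg_of_ne_zero, Nat.cast_sub x.val_le]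
      ring
  have h2 := Finset.sum_congr (rfl : (univ : Finset (ZMod p)) = univ) fun x _ ↦ h1 x
  have h3 := Equiv.sum_comp (Equiv.neg (ZMod p))
    (fun x ↦ (x.val : ℂ) * (quadraticChar (ZMod p) x : ℂ))
  simp only [Equiv.neg_apply] at h3
  rw [Finset.sum_add_distrib, ← Finset.mul_sum, hsum, mul_zero, h3] at h2
  linear_combination h2 / 2

end ClassNumberFormula

/-- **Class numbers via 3-isogenies and elliptic surfaces** (Main Theorem).
Let `p ≡ 1 (mod 3)` be prime, `β² = -27` in `F_p`, and `χ` a multiplicative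
character of order 3 on `F_p` (with values in `ℂ`, extended by `χ 0 = 0`).
Then the global character sum over the elliptic surface `y² = x³ - 27z²`
equals `p·(h_p* - (p-1)/2)`, where `h_p*` is the class number of `ℚ(√-p)`
when `p ≡ 3 (mod 4)` and `0` otherwise. -/
theorem global_sum_eq_class_number
    (p : ℕ) [Fact p.Prime] (hp3 : p % 3 = 1)
    (β : ZMod p) (hβ : β ^ 2 = -27)
    (χ : MulChar (ZMod p) ℂ) (hχ : orderOf χ = 3)
    (K : Type) [Field K] [NumberField K]
    [IsSplittingField ℚ K (X ^ 2 + C (p : ℚ))]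
    (hps : ℕ) (hhps : hps = if p % 4 = 3 then NumberField.classNumber K else 0) :
    (∑ z ∈ univ.filter (fun z : ZMod p => z ≠ 0),
        ∑ P ∈ univ.filter
            (fun P : ZMod p × ZMod p => P.2 ^ 2 = P.1 ^ 3 - 27 * z ^ 2),
          (P.1.val : ℂ) * χ (P.2 - β * z))
      = (p : ℂ) * ((hps : ℂ) - ((p : ℂ) - 1) / 2) := by
  have hpp : p.Prime := Fact.out
  rw [global_sum_eq_quadraticChar_sum p hp3 β hβ χ hχ]
  rcases hpp.eq_two_or_odd with h2 | h2
  · omega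
  by_cases hp4 : p % 4 = 3
  · obtain ⟨α, hα, hspan⟩ := exists_sq_eq_neg_of_isSplittingField p K
    rw [if_pos hp4] at hhps
    have hp7 : 5 ≤ p := by
      have := hpp.two_le
      omega
    rw [classNumber_eq_sum hp4 hp7 hα hspan, hhps]
    ring
  · rw [if_neg hp4] at hhps
    rw [sum_val_mul_quadraticChar_eq_zero (by omega), hhps]
    push_cast
    ring
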